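/- arXiv:1908.01649 — 2 statements merged into one kernel-verified Lean document; each statement's English description precedes it below -/
import Mathlib

section
/- Let G be a finite non-cyclic 2-generated group such that C2 × C2 is not an epimorphic image of G. If the number of ordered pairs (x, y) ∈ G × G with ⟨x, y⟩ = G is strictly less than 6·|G|, then G is isomorphic to one of: D3 (dihedral of order 6), C3 × C3, or A4 (the alternating group of degree 4). -/
namespace GenPairs

/-- `x, y` generate `G`. -/
def Gen {G : Type*} [Group G] (x y : G) : Prop := Subgroup.closure {x, y} = ⊤

/-- Number of generating pairs. -/
noncomputable def np (G : Type*) [Group G] : ℕ := Nat.card {p : G × G | Gen p.1 p.2}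

/-- Simultaneous conjugacy of pairs. -/
def Cj {G : Type*} [Group G] (p q : G × G) : Prop :=
  ∃ h : G, h * p.1 * h⁻¹ = q.1 ∧ h * p.2 * h⁻¹ = q.2

section basic
variable {G : Type*} [Group G]

theorem gen_iff {x y : G} : Gen x y ↔ ∀ H : Subgroup G, x ∈ H → y ∈ H → H = ⊤ := by
  unfold Gen
  constructor
  · intro h H hx hy
    rw [eq_top_iff, ← h, Subgroup.closure_le]
    rintro z (rfl | rfl)
    · exact hx
    · exact hy
  · intro h
    exact h _ (Subgroup.subset_closure (by simp)) (Subgroup.subset_closure (by simp))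

theorem Gen.symm {x y : G} (h : Gen x y) : Gen y x := by
  rw [gen_iff] at *
  exact fun H a b => h H b a

/-- transfer of generation -/
theorem Gen.trans {x y u v : G} (h : Gen x y)
    (h' : ∀ H : Subgroup G, u ∈ H → v ∈ H → x ∈ H ∧ y ∈ H) : Gen u v := by
  rw [gen_iff] at *
  exact fun H a b => h H (h' H a b).1 (h' H a b).2

theorem Gen.conj {x y : G} (h : Gen x y) (g : G) : Gen (g * x * g⁻¹) (g * y * g⁻¹) := by
  rw [gen_iff] at *
  intro H hx hy
  have := h (H.comap (MulAut.conj g).toMonoidHom) (by simpa using hx) (by simpa using hy)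
  rw [eq_top_iff]
  intro z _
  have hz : g⁻¹ * z * g ∈ H.comap (MulAut.conj g).toMonoidHom := by rw [this]; trivial
  simpa [mul_assoc] using hz

theorem Gen.map {K : Type*} [Group K] {x y : G} (h : Gen x y) (f : G →* K)
    (hf : Function.Surjective f) : Gen (f x) (f y) := by
  rw [gen_iff] at *
  intro H hx hy
  have := h (H.comap f) hx hy
  rw [eq_top_iff]
  intro z _
  obtain ⟨w, rfl⟩ := hf z
  have hw : w ∈ H.comap f := by rw [this]; trivial
  exact hw

theorem mem_center_of_gen {x y h : G} (hg : Gen x y) (hx : h * x = x * h) (hy : h * y = y * h) :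
    h ∈ Subgroup.center G := by
  rw [gen_iff] at hg
  have := hg (Subgroup.centralizer {h}) (by rw [Subgroup.mem_centralizer_singleton_iff]; exact hx.symm)
    (by rw [Subgroup.mem_centralizer_singleton_iff]; exact hy.symm)
  rw [Subgroup.mem_center_iff]
  intro g
  have hh : g ∈ Subgroup.centralizer {h} := by rw [this]; trivial
  rw [Subgroup.mem_centralizer_singleton_iff] at hh
  exact hh

theorem eq_one_of_gen (hZ : Subgroup.center G = ⊥) {x y h : G} (hg : Gen x y)
    (hx : h * x = x * h) (hy : h * y = y * h) : h = 1 := by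
  have := mem_center_of_gen hg hx hy
  rwa [hZ, Subgroup.mem_bot] at this

theorem Cj.symm {p q : G × G} (h : Cj p q) : Cj q p := by
  obtain ⟨g, h1, h2⟩ := h
  refine ⟨g⁻¹, ?_, ?_⟩
  · rw [← h1]; group
  · rw [← h2]; group

variable [Finite G]

/-- a subgroup which is normalized by `h` and generates `G` together with `h`
contains the derived group. -/
theorem commutator_le_of (H : Subgroup G) (h : G) (hn : ∀ k ∈ H, h * k * h⁻¹ ∈ H)
    (hg : ∀ K : Subgroup G, H ≤ K → h ∈ K → K = ⊤) : commutator G ≤ H := by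
  have hnorm : h ∈ Subgroup.normalizer (H : Set G) := by
    have hm : H.map (MulAut.conj h).toMonoidHom ≤ H := by
      rintro _ ⟨k, hk, rfl⟩
      exact hn k hk
    have hc : Nat.card (H.map (MulAut.conj h).toMonoidHom) = Nat.card H :=
      (Nat.card_congr (H.equivMapOfInjective _ (MulAut.conj h).injective).toEquiv).symm
    have he : H.map (MulAut.conj h).toMonoidHom = H :=
      Subgroup.eq_of_le_of_card_ge hm hc.ge
    rw [Subgroup.mem_normalizer_iff]
    intro k
    constructor
    · exact hn k
    · intro hk
      rw [← he] at hk
      obtain ⟨k', hk', e⟩ := hk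
      have : k' = k := by simpa using e
      rw [← this]; exact hk'
  have hN : H.Normal := by
    rw [← Subgroup.normalizer_eq_top_iff]
    exact hg _ Subgroup.le_normalizer hnorm
  have key : ∀ g : G, (QuotientGroup.mk g : G ⧸ H) ∈ Subgroup.zpowers (QuotientGroup.mk h : G ⧸ H) := by
    have := hg ((Subgroup.zpowers (QuotientGroup.mk h : G ⧸ H)).comap (QuotientGroup.mk' H))
      (by
        intro k hk
        have : (QuotientGroup.mk k : G ⧸ H) = 1 := (QuotientGroup.eq_one_iff k).2 hk
        simp [Subgroup.mem_comap, this])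
      (by simp [Subgroup.mem_comap])
    intro g
    have hgm : g ∈ ((Subgroup.zpowers (QuotientGroup.mk h : G ⧸ H)).comap (QuotientGroup.mk' H)) := by
      rw [this]; trivial
    exact hgm
  rw [commutator_def, Subgroup.commutator_le]
  intro a _ b _
  rw [← QuotientGroup.eq_one_iff]
  obtain ⟨i, hi⟩ := key a
  obtain ⟨j, hj⟩ := key b
  simp only [commutatorElement_def, QuotientGroup.mk_mul, QuotientGroup.mk_inv]
  simp only at hi hj
  rw [← hi, ← hj]
  group

/-- counting lemma: pairwise non conjugate generating pairs -/
theorem conj_count {ι : Type*} [Finite ι] (S : Set (G × G)) (f : ι → G × G)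
    (hS : ∀ i g, (g * (f i).1 * g⁻¹, g * (f i).2 * g⁻¹) ∈ S)
    (hgen : ∀ i, Gen (f i).1 (f i).2) (hne : ∀ i j, Cj (f i) (f j) → i = j) :
    Nat.card ι * Nat.card (G ⧸ Subgroup.center G) ≤ Nat.card S := by
  rw [← Nat.card_prod]
  let F : ι × (G ⧸ Subgroup.center G) → S := fun p =>
    ⟨(p.2.out * (f p.1).1 * (p.2.out)⁻¹, p.2.out * (f p.1).2 * (p.2.out)⁻¹), hS _ _⟩
  apply Nat.card_le_card_of_injective F
  rintro ⟨i, q⟩ ⟨j, r⟩ h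
  simp only [F, Subtype.mk.injEq, Prod.mk.injEq] at h
  obtain ⟨h1, h2⟩ := h
  have hij : i = j := by
    apply hne
    refine ⟨r.out⁻¹ * q.out, ?_, ?_⟩
    · calc _ = r.out⁻¹ * (q.out * (f i).1 * q.out⁻¹) * r.out := by group
        _ = _ := by rw [h1]; group
    · calc _ = r.out⁻¹ * (q.out * (f i).2 * q.out⁻¹) * r.out := by group
        _ = _ := by rw [h2]; group
  subst hij
  have hc : r.out⁻¹ * q.out ∈ Subgroup.center G := by
    apply mem_center_of_gen (hgen i)
    · calc _ = r.out⁻¹ * (q.out * (f i).1 * q.out⁻¹) * q.out := by group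
        _ = _ := by rw [h1]; group
    · calc _ = r.out⁻¹ * (q.out * (f i).2 * q.out⁻¹) * q.out := by group
        _ = _ := by rw [h2]; group
  have : r = q := by
    rw [← QuotientGroup.eq, QuotientGroup.out_eq', QuotientGroup.out_eq'] at hc
    exact hc
  rw [this]

theorem conj_count' (hZ : Subgroup.center G = ⊥) {ι : Type*} [Finite ι] (f : ι → G × G)
    (hgen : ∀ i, Gen (f i).1 (f i).2) (hne : ∀ i j, Cj (f i) (f j) → i = j) :
    Nat.card ι * Nat.card G ≤ np G := by
  have h := conj_count {p : G × G | Gen p.1 p.2} f (fun i g => (hgen i).conj g) hgen hne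
  have e : Nat.card (G ⧸ Subgroup.center G) = Nat.card G := by
    rw [hZ]
    exact Nat.card_congr QuotientGroup.quotientBot.toEquiv
  rw [e] at h
  exact h

end basic

end GenPairs

namespace GenPairs
set_option linter.unusedSectionVars false
section perfect
variable {G : Type*} [Group G] [Finite G]

theorem perf_top (hP : commutator G = ⊤) (H : Subgroup G) (h : G) (hn : ∀ k ∈ H, h * k * h⁻¹ ∈ H)
    (hg : ∀ K : Subgroup G, H ≤ K → h ∈ K → K = ⊤) : H = ⊤ := by
  rw [eq_top_iff, ← hP]
  exact commutator_le_of H h hn hg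

theorem perf_abel [Nontrivial G] (hP : commutator G = ⊤) (hc : ∀ a b : G, a * b = b * a) : False := by
  have : commutator G = ⊥ := by
    rw [commutator_def, Subgroup.commutator_eq_bot_iff_le_centralizer]
    intro a _ 
    rw [Subgroup.mem_centralizer_iff]
    intro b _
    exact hc b a
  rw [hP] at this
  exact top_ne_bot this

/-- abelian subgroup normalized by `x` and generating with `x` is impossible. -/
theorem perf_closure [Nontrivial G] (hP : commutator G = ⊤) (s : Set G) (x : G)
    (hs : ∀ a ∈ s, ∀ b ∈ s, a * b = b * a)
    (hn : ∀ k ∈ s, x * k * x⁻¹ ∈ Subgroup.closure s)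
    (hg : ∀ K : Subgroup G, s ⊆ K → x ∈ K → K = ⊤) : False := by
  have ht : Subgroup.closure s = ⊤ := by
    apply perf_top hP _ x
    · intro k hk
      have : Subgroup.closure s ≤ (Subgroup.closure s).comap (MulAut.conj x).toMonoidHom := by
        rw [Subgroup.closure_le]
        intro k hk
        simpa using hn k hk
      simpa using this hk
    · intro K hK hx
      exact hg K (Subgroup.subset_closure.trans hK) hx
  apply perf_abel hP
  have h1 : s ⊆ Subgroup.centralizer s := by
    intro a ha
    rw [SetLike.mem_coe, Subgroup.mem_centralizer_iff]
    intro b hb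
    exact hs b hb a ha
  have h2 : Subgroup.centralizer s = ⊤ := by
    rw [eq_top_iff, ← ht, Subgroup.closure_le]; exact h1
  have h3 : s ⊆ Subgroup.center G := by
    intro a ha
    rw [SetLike.mem_coe, Subgroup.mem_center_iff]
    intro g
    have : g ∈ Subgroup.centralizer s := by rw [h2]; trivial
    rw [Subgroup.mem_centralizer_iff] at this
    exact (this a ha).symm
  have h4 : Subgroup.center G = ⊤ := by
    rw [eq_top_iff, ← ht, Subgroup.closure_le]; exact h3
  intro a b
  have : a ∈ Subgroup.center G := by rw [h4]; trivial
  rw [Subgroup.mem_center_iff] at this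
  exact (this b).symm

theorem sq_inv {g : G} (hg : g ^ 2 = 1) : g⁻¹ = g := by
  rw [inv_eq_iff_mul_eq_one, ← sq, hg]

theorem inv_sep (hP : commutator G = ⊤) (hZ : Subgroup.center G = ⊥) {x g : G} (hxg : Gen x g)
    (hg : g ^ 2 = 1) {i j : ℕ} (h : Cj (x, x ^ i * g) (x, x ^ j * g)) : x ^ i = x ^ j := by
  obtain ⟨k, h1, h2⟩ := h
  simp only at h1 h2
  have hgi := sq_inv hg
  set c := (x ^ i)⁻¹ * x ^ j with hc
  have hk : k * x = x * k := by rw [mul_inv_eq_iff_eq_mul] at h1; exact h1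
  have hk' : k * x ^ i = x ^ i * k := (Commute.pow_right (show Commute k x from hk) i)
  have e : k * g * k⁻¹ = c * g := by
    have : x ^ i * (k * g * k⁻¹) = x ^ j * g := by
      rw [← h2]
      calc _ = (x ^ i * k) * g * k⁻¹ := by group
        _ = _ := by rw [← hk']; group
    rw [hc, mul_assoc (x ^ i)⁻¹, ← this]; group
  have e2 : c * g * (c * g) = 1 := by
    rw [← e]
    calc _ = k * g ^ 2 * k⁻¹ := by rw [sq]; group
      _ = 1 := by rw [hg]; group
  have e3 : g * c * g⁻¹ = c⁻¹ := by
    rw [hgi, eq_inv_iff_mul_eq_one, eq_comm, ← mul_one (g * c * g * c)]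
    have : g * c * g * c = c⁻¹ * (c * g * (c * g)) * c := by group
    rw [this, e2]; group
  have hcx : c * x = x * c := by
    have : Commute c x := by
      apply Commute.mul_left
      · exact (Commute.pow_self x i).inv_left
      · exact Commute.pow_self x j
    exact this
  have ht : Subgroup.centralizer {c} = ⊤ := by
    apply perf_top hP _ g
    · intro k hk
      rw [Subgroup.mem_centralizer_singleton_iff] at *
      have hk2 : Commute (g * k * g⁻¹) (g * c * g⁻¹) := by
        show _ * _ = _ * _
        calc _ = g * (k * c) * g⁻¹ := by group
          _ = _ := by rw [hk]; group
      rw [e3] at hk2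
      exact (Commute.inv_right_iff.1 hk2).eq
    · intro K hK hgK
      rw [gen_iff] at hxg
      exact hxg K (hK (by rw [Subgroup.mem_centralizer_singleton_iff]; exact hcx.symm)) hgK
  have hc1 : c = 1 := by
    have : c ∈ Subgroup.center G := by
      rw [Subgroup.mem_center_iff]
      intro y
      have : y ∈ Subgroup.centralizer {c} := by rw [ht]; trivial
      rw [Subgroup.mem_centralizer_singleton_iff] at this
      exact this
    rwa [hZ, Subgroup.mem_bot] at this
  rw [hc, inv_mul_eq_one] at hc1
  exact hc1

theorem order_ge_three [Nontrivial G] (hP : commutator G = ⊤) {x g : G} (hxg : Gen x g)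
    (hg : g ^ 2 = 1) : 3 ≤ orderOf x := by
  by_contra hlt
  have hpos := orderOf_pos x
  have hx : x ^ 2 = 1 := by
    rw [← orderOf_dvd_iff_pow_eq_one]
    have : orderOf x = 1 ∨ orderOf x = 2 := by omega
    rcases this with h | h <;> simp [h]
  rw [gen_iff] at hxg
  have hgi := sq_inv hg
  have hxi := sq_inv hx
  apply perf_closure hP {x * g} g
  · rintro a rfl b rfl; rfl
  · rintro a rfl
    have : g * (x * g) * g⁻¹ = (x * g)⁻¹ := by
      rw [mul_inv_rev, hgi, hxi, mul_assoc, mul_assoc, ← sq, hg, mul_one]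
    rw [this]
    exact inv_mem (Subgroup.subset_closure rfl)
  · intro K hK hgK
    refine hxg K ?_ hgK
    have : x = (x * g) * g⁻¹ := by group
    rw [this]
    exact K.mul_mem (hK rfl) (K.inv_mem hgK)

theorem no_233 [Nontrivial G] (hP : commutator G = ⊤) {x g : G} (hxg : Gen x g)
    (hg : g ^ 2 = 1) (hx : x ^ 3 = 1) (hz : (x * g) ^ 3 = 1) : False := by
  have hgi := sq_inv hg
  rw [gen_iff] at hxg
  -- `x g x⁻¹ · x² g x⁻² · g = 1`
  have r1 : (x * g * x⁻¹) * (x ^ 2 * g * (x ^ 2)⁻¹) * g = 1 := by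
    have : (x * g * x⁻¹) * (x ^ 2 * g * (x ^ 2)⁻¹) * g
      = (x * g) ^ 3 * (g⁻¹ * (x ^ 3)⁻¹ * g) := by
      simp only [pow_succ, pow_zero, one_mul]; group
    rw [this, hz, hx]; group
  have sb : (x * g * x⁻¹) * (x * g * x⁻¹) = 1 := by
    calc _ = x * g ^ 2 * x⁻¹ := by rw [sq]; group
      _ = 1 := by rw [hg]; group
  have sc : (x ^ 2 * g * (x ^ 2)⁻¹) * (x ^ 2 * g * (x ^ 2)⁻¹) = 1 := by
    calc _ = x ^ 2 * g ^ 2 * (x ^ 2)⁻¹ := by rw [sq g]; group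
      _ = 1 := by rw [hg]; group
  have sa : g * g = 1 := by rw [← sq, hg]
  set b := x * g * x⁻¹ with hb
  set c := x ^ 2 * g * (x ^ 2)⁻¹ with hc
  have hcb : c = b * g := by
    have : b * (b * c * g) * g = b * g := by rw [r1]; group
    rw [← this]
    calc c = 1 * c * 1 := by group
      _ = (b * b) * c * (g * g) := by rw [sb, sa]
      _ = _ := by group
  have hcomm : b * g = g * b := by
    have h1 : b * g * (b * g) = 1 := by rw [← hcb]; exact sc
    have hbi : b⁻¹ = b := by rw [inv_eq_iff_mul_eq_one, sb]
    have : b * g = (b * g)⁻¹ := by rw [eq_inv_iff_mul_eq_one, h1]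
    rw [this, mul_inv_rev, hgi, hbi]
  apply perf_closure hP {g, b} x
  · rintro u (rfl | rfl) v (rfl | rfl)
    · rfl
    · exact hcomm.symm
    · exact hcomm
    · rfl
  · rintro u (rfl | rfl)
    · exact Subgroup.subset_closure (by simp [hb])
    · have : x * b * x⁻¹ = b * g := by
        rw [← hcb, hb, hc]; simp only [sq]; group
      rw [this]
      exact mul_mem (Subgroup.subset_closure (by simp)) (Subgroup.subset_closure (by simp))
  · intro K hK hx
    exact hxg K hx (hK (by simp))

theorem no_244 [Nontrivial G] (hP : commutator G = ⊤) {x g : G} (hxg : Gen x g)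
    (hg : g ^ 2 = 1) (hx : x ^ 4 = 1) (hz : (x * g) ^ 4 = 1) : False := by
  have hgi := sq_inv hg
  rw [gen_iff] at hxg
  have hx3 : x ^ 3 = x⁻¹ := by rw [eq_inv_iff_mul_eq_one, ← pow_succ, hx]
  have hz2 : (x * g) * (x * g) = g * x⁻¹ * g * x⁻¹ := by
    have h1 : ((x * g) * (x * g)) * ((x * g) * (x * g)) = 1 := by
      rw [← hz]; simp only [pow_succ, pow_zero, one_mul]; group
    rw [← eq_inv_iff_mul_eq_one] at h1
    rw [h1]; simp [mul_inv_rev, hgi, mul_assoc]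
  have hxx : (x ^ 2)⁻¹ = x ^ 2 := by
    rw [inv_eq_iff_mul_eq_one, ← pow_add, hx]
  apply perf_closure hP {x ^ 2 * g, x ^ 3 * g * x⁻¹} x
  · have hcomm : (x ^ 2 * g) * (x ^ 3 * g * x⁻¹) = (x ^ 3 * g * x⁻¹) * (x ^ 2 * g) := by
      calc _ = x ^ 2 * (g * x ^ 3 * g * x⁻¹) := by group
        _ = x ^ 2 * (g * x⁻¹ * g * x⁻¹) := by rw [hx3]
        _ = x ^ 2 * ((x * g) * (x * g)) := by rw [hz2]
        _ = _ := by simp only [pow_succ, pow_zero, one_mul]; group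
    rintro u (rfl | rfl) v (rfl | rfl)
    · rfl
    · exact hcomm
    · exact hcomm.symm
    · rfl
  · rintro u (rfl | rfl)
    · have : x * (x ^ 2 * g) * x⁻¹ = x ^ 3 * g * x⁻¹ := by group
      rw [this]
      exact Subgroup.subset_closure (by simp)
    · have : x * (x ^ 3 * g * x⁻¹) * x⁻¹ = (x ^ 2 * g)⁻¹ := by
        calc _ = x ^ 4 * g * (x ^ 2)⁻¹ := by group
          _ = _ := by rw [hx, mul_inv_rev, hgi, one_mul]
      rw [this]
      exact inv_mem (Subgroup.subset_closure (by simp))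
  · intro K hK hx
    refine hxg K hx ?_
    have : g = (x ^ 2)⁻¹ * (x ^ 2 * g) := by group
    rw [this]
    exact K.mul_mem (K.inv_mem (K.pow_mem hx 2)) (hK (by simp))

theorem no_333 [Nontrivial G] (hP : commutator G = ⊤) {x u : G} (hxg : Gen x u)
    (hu : u ^ 3 = 1) (hx : x ^ 3 = 1) (hz : (x * u) ^ 3 = 1) : False := by
  rw [gen_iff] at hxg
  have hx2 : x ^ 2 = x⁻¹ := by rw [eq_inv_iff_mul_eq_one, ← pow_succ, hx]
  have hu2 : u ^ 2 = u⁻¹ := by rw [eq_inv_iff_mul_eq_one, ← pow_succ, hu]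
  have hz2 : u⁻¹ * x⁻¹ * u⁻¹ * x⁻¹ = x * u := by
    have h1 : (x * u) * ((x * u) * (x * u)) = 1 := by
      rw [← hz]; simp only [pow_succ, pow_zero, one_mul]; group
    rw [← eq_inv_iff_mul_eq_one] at h1
    rw [h1]; simp [mul_inv_rev, mul_assoc]
  apply perf_closure hP {x * u⁻¹, x ^ 2 * u⁻¹ * x⁻¹} x
  · have hcomm : (x * u⁻¹) * (x ^ 2 * u⁻¹ * x⁻¹) = (x ^ 2 * u⁻¹ * x⁻¹) * (x * u⁻¹) := by
      calc _ = x * (u⁻¹ * x ^ 2 * u⁻¹ * x⁻¹) := by group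
        _ = x * (x * u) := by rw [hx2, hz2]
        _ = x ^ 2 * (u ^ 2)⁻¹ := by rw [hu2, sq]; group
        _ = _ := by simp only [sq]; group
    rintro u (rfl | rfl) v (rfl | rfl)
    · rfl
    · exact hcomm
    · exact hcomm.symm
    · rfl
  · rintro v (rfl | rfl)
    · have : x * (x * u⁻¹) * x⁻¹ = x ^ 2 * u⁻¹ * x⁻¹ := by simp only [sq]; group
      rw [this]
      exact Subgroup.subset_closure (by simp)
    · have : x * (x ^ 2 * u⁻¹ * x⁻¹) * x⁻¹ = (x * u⁻¹)⁻¹ * (x ^ 2 * u⁻¹ * x⁻¹)⁻¹ := by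
        calc _ = x ^ 3 * u⁻¹ * (x ^ 2)⁻¹ := by group
          _ = u ^ 2 * (x ^ 2)⁻¹ := by rw [hx, hu2, one_mul]
          _ = _ := by simp only [sq]; group
      rw [this]
      exact mul_mem (inv_mem (Subgroup.subset_closure (by simp)))
        (inv_mem (Subgroup.subset_closure (by simp)))
  · intro K hK hx
    refine hxg K hx ?_
    have : u = (x * u⁻¹)⁻¹ * x := by group
    rw [this]
    exact K.mul_mem (K.inv_mem (hK (by simp))) hx

theorem orderOf_conj' (h x : G) : orderOf (h * x * h⁻¹) = orderOf x :=
  orderOf_injective (MulAut.conj h).toMonoidHom (MulAut.conj h).injective x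

theorem gen_pow {x g : G} (h : Gen x g) (i : ℕ) : Gen x (x ^ i * g) := by
  apply h.trans
  intro H hx hg
  refine ⟨hx, ?_⟩
  have : g = (x ^ i)⁻¹ * (x ^ i * g) := by group
  rw [this]
  exact H.mul_mem (H.inv_mem (H.pow_mem hx i)) hg

theorem inv_case [Nontrivial G] (hP : commutator G = ⊤) (hZ : Subgroup.center G = ⊥) {x g : G}
    (hxg : Gen x g) (hg : g ^ 2 = 1) : 6 * Nat.card G ≤ np G := by
  have hzg : Gen (x * g) g := by
    apply hxg.trans
    intro H h1 h2
    refine ⟨?_, h2⟩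
    have : x = (x * g) * g⁻¹ := by group
    rw [this]
    exact H.mul_mem h1 (H.inv_mem h2)
  have hx3 := order_ge_three hP hxg hg
  have hz3 := order_ge_three hP hzg hg
  have key : ∀ y : G, Gen y g → ∀ i j : Fin (orderOf y),
      Cj (y, y ^ (i : ℕ) * g) (y, y ^ (j : ℕ) * g) → i = j := by
    intro y hy i j h
    exact Fin.ext (pow_injOn_Iio_orderOf i.2 j.2 (inv_sep hP hZ hy hg h))
  by_cases hne : orderOf x = orderOf (x * g)
  · have h34 : orderOf x ≠ 3 := by
      intro h
      apply no_233 hP hxg hg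
      · rw [← h, pow_orderOf_eq_one]
      · rw [← h, hne, pow_orderOf_eq_one]
    have h44 : orderOf x ≠ 4 := by
      intro h
      apply no_244 hP hxg hg
      · rw [← h, pow_orderOf_eq_one]
      · rw [← h, hne, pow_orderOf_eq_one]
    have := conj_count' hZ (ι := Fin (orderOf x) ⊕ Unit)
      (Sum.elim (fun i => (x, x ^ (i : ℕ) * g)) (fun _ => (g, x)))
      (by rintro (i | i)
          · exact gen_pow hxg i
          · exact hxg.symm)
      (by
        have ho : orderOf g ∣ 2 := orderOf_dvd_of_pow_eq_one hg
        have ho' := Nat.le_of_dvd (by norm_num) ho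
        rintro (i | i) (j | j) h
        · rw [key x hxg i j h]
        · obtain ⟨k, h1, h2⟩ := h
          simp only [Sum.elim_inl, Sum.elim_inr] at h1
          have := orderOf_conj' k x
          rw [h1] at this; omega
        · obtain ⟨k, h1, h2⟩ := h
          simp only [Sum.elim_inl, Sum.elim_inr] at h1
          have := orderOf_conj' k g
          rw [h1] at this; omega
        · rfl)
    refine le_trans (Nat.mul_le_mul_right _ ?_) this
    rw [Nat.card_sum]; simp; omega
  · have := conj_count' hZ (ι := Fin (orderOf x) ⊕ Fin (orderOf (x * g)))
      (Sum.elim (fun i => (x, x ^ (i : ℕ) * g)) (fun i => (x * g, (x * g) ^ (i : ℕ) * g)))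
      (by rintro (i | i)
          · exact gen_pow hxg i
          · exact gen_pow hzg i)
      (by
        rintro (i | i) (j | j) h
        · rw [key x hxg i j h]
        · obtain ⟨k, h1, h2⟩ := h
          simp only [Sum.elim_inl, Sum.elim_inr] at h1
          have := orderOf_conj' k x
          rw [h1] at this; omega
        · obtain ⟨k, h1, h2⟩ := h
          simp only [Sum.elim_inl, Sum.elim_inr] at h1
          have := orderOf_conj' k (x * g)
          rw [h1] at this; omega
        · rw [key (x * g) hzg i j h])
    refine le_trans (Nat.mul_le_mul_right _ ?_) this
    rw [Nat.card_sum]; simp; omega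

end perfect
end GenPairs

namespace GenPairs
set_option linter.unusedSectionVars false
section perfect2
variable {G : Type*} [Group G] [Finite G]

theorem seq_case [Nontrivial G] (hP : commutator G = ⊤) {x : G} (S : Set G) (hne : S.Nonempty)
    (hgen : ∀ u ∈ S, Gen u x)
    (hstep : ∀ u ∈ S, ∃ h ∈ S, h * u = u * h ∧ h * x * h⁻¹ = x * u) : False := by
  obtain ⟨u0, hu0⟩ := hne
  choose! nx h1 h2 h3 using hstep
  let s : ℕ → G := fun n => nx^[n] u0
  have hs : ∀ n, s n ∈ S := by
    intro n
    induction n with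
    | zero => exact hu0
    | succ n ih => simp only [s, Function.iterate_succ_apply']; exact h1 _ ih
  have hss : ∀ n, s (n + 1) = nx (s n) := fun n => Function.iterate_succ_apply' nx n u0
  have hc1 : ∀ n, Commute (s (n + 1)) (s n) := fun n => by rw [hss]; exact h2 _ (hs n)
  have hx : ∀ n, x⁻¹ * s (n + 1) * x = s (n + 1) * (s n)  := by
    intro n
    have := h3 _ (hs n)
    rw [← hss, mul_inv_eq_iff_eq_mul] at this
    rw [mul_assoc, this, (hc1 n).eq]; group
  have hcomm : ∀ d, ∀ e ≤ d, ∀ n, Commute (s n) (s (n + e)) := by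
    intro d
    induction d with
    | zero =>
      intro e he n
      obtain rfl : e = 0 := by omega
      exact Commute.refl _
    | succ d ih =>
      intro e he n
      rcases Nat.lt_or_ge e (d + 1) with h | h
      · exact ih e (by omega) n
      obtain rfl : e = d + 1 := by omega
      rcases Nat.eq_zero_or_pos d with rfl | hd
      · exact (hc1 n).symm
      have c1 : Commute (s (n + 1)) (s (n + 1 + d)) := ih d le_rfl (n + 1)
      have c2 : Commute (x⁻¹ * s (n + 1) * x) (x⁻¹ * s (n + 1 + d) * x) := by
        show _ * _ = _ * _
        calc _ = x⁻¹ * (s (n + 1) * s (n + 1 + d)) * x := by group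
          _ = _ := by rw [c1.eq]; group
      have hx' : x⁻¹ * s (n + 1 + d) * x = s (n + 1 + d) * s (n + d) := by
        have := hx (n + d)
        rw [show n + d + 1 = n + 1 + d by omega] at this
        exact this
      rw [hx, hx'] at c2
      have c3 : Commute (s (n + 1)) (s (n + d)) := by
        have := ih (d - 1) (by omega) (n + 1)
        rwa [show n + 1 + (d - 1) = n + d by omega] at this
      have c4 : Commute (s n) (s (n + d)) := ih d le_rfl n
      -- remove s (n+1)
      have c5 : Commute (s n) (s (n + 1 + d) * s (n + d)) := by
        have := (c1.mul_right c3).inv_left.mul_left c2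
        simpa using this
      have c6 := c5.mul_right c4.inv_right
      rw [mul_inv_cancel_right] at c6
      rwa [show n + (d + 1) = n + 1 + d by omega]
  have hcm : ∀ i j, Commute (s i) (s j) := by
    intro i j
    rcases le_total i j with h | h
    · obtain ⟨k, rfl⟩ := Nat.exists_eq_add_of_le h
      exact hcomm k k le_rfl i
    · obtain ⟨k, rfl⟩ := Nat.exists_eq_add_of_le h
      exact (hcomm k k le_rfl j).symm
  let V : ℕ → Subgroup G := fun k => Subgroup.closure {a | ∃ i, k ≤ i ∧ a = s i}
  have hanti : Antitone V := by
    intro a b hab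
    apply Subgroup.closure_mono
    rintro _ ⟨i, hi, rfl⟩
    exact ⟨i, hab.trans hi, rfl⟩
  obtain ⟨k, hk⟩ : ∃ k, V k = V (k + 1) := by
    by_contra hcon
    push Not at hcon
    have : StrictAnti V := strictAnti_nat_of_succ_lt fun n =>
      lt_of_le_of_ne (hanti (Nat.le_succ n)) (hcon n).symm
    exact not_injective_infinite_finite V this.injective
  apply perf_closure hP {a | ∃ i, k + 1 ≤ i ∧ a = s i} x⁻¹
  · rintro _ ⟨i, _, rfl⟩ _ ⟨j, _, rfl⟩
    exact (hcm i j).eq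
  · rintro _ ⟨i, hi, rfl⟩
    obtain ⟨i, rfl⟩ : ∃ j, i = j + 1 := ⟨i - 1, by omega⟩
    rw [inv_inv, hx]
    change _ ∈ V (k + 1)
    rw [← hk]
    exact mul_mem (Subgroup.subset_closure ⟨i + 1, by omega, rfl⟩)
      (Subgroup.subset_closure ⟨i, by omega, rfl⟩)
  · intro K hK hxK
    exact gen_iff.1 (hgen _ (hs (k + 1))) K (hK ⟨k + 1, le_rfl, rfl⟩) (by simpa using hxK)

theorem conj_cube (h x : G) : (h * x * h⁻¹) ^ 3 = 1 ↔ x ^ 3 = 1 := by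
  rw [conj_pow]
  constructor
  · intro e
    rw [mul_inv_eq_one] at e
    simpa using e
  · intro e; rw [e]; group

theorem pairwise_six {R : G × G → G × G → Prop} (hs : ∀ p q, R p q → R q p)
    (a0 a1 a2 a3 a4 a5 : G × G)
    (h01 : ¬ R a0 a1) (h02 : ¬ R a0 a2) (h03 : ¬ R a0 a3) (h04 : ¬ R a0 a4) (h05 : ¬ R a0 a5)
    (h12 : ¬ R a1 a2) (h13 : ¬ R a1 a3) (h14 : ¬ R a1 a4) (h15 : ¬ R a1 a5)
    (h23 : ¬ R a2 a3) (h24 : ¬ R a2 a4) (h25 : ¬ R a2 a5)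
    (h34 : ¬ R a3 a4) (h35 : ¬ R a3 a5) (h45 : ¬ R a4 a5) :
    ∀ i j : Fin 6, R (![a0, a1, a2, a3, a4, a5] i) (![a0, a1, a2, a3, a4, a5] j) → i = j := by
  have key : ∀ i j : Fin 6, i < j →
      ¬ R (![a0, a1, a2, a3, a4, a5] i) (![a0, a1, a2, a3, a4, a5] j) := by
    intro i j hij
    fin_cases i <;> fin_cases j <;> first | (exfalso; revert hij; decide) | assumption
  intro i j h
  rcases lt_trichotomy i j with h' | h' | h'
  · exact absurd h (key i j h')
  · exact h'
  · exact absurd (hs _ _ h) (key j i h')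

theorem six_count (hZ : Subgroup.center G = ⊥)
    (a0 a1 a2 a3 a4 a5 : G × G)
    (g0 : Gen a0.1 a0.2) (g1 : Gen a1.1 a1.2) (g2 : Gen a2.1 a2.2) (g3 : Gen a3.1 a3.2)
    (g4 : Gen a4.1 a4.2) (g5 : Gen a5.1 a5.2)
    (h : ∀ i j : Fin 6, Cj (![a0, a1, a2, a3, a4, a5] i) (![a0, a1, a2, a3, a4, a5] j) → i = j) :
    6 * Nat.card G ≤ np G := by
  have := conj_count' hZ (ι := Fin 6) ![a0, a1, a2, a3, a4, a5]
    (by intro i; fin_cases i <;> assumption) h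
  simpa using this

/-- closing membership goals -/
theorem gen_mul_right {x u : G} (h : Gen u x) : Gen u (x * u) := by
  apply h.trans
  intro H h1 h2
  refine ⟨h1, ?_⟩
  have := H.mul_mem h2 (H.inv_mem h1)
  simpa using this

theorem three_final [Nontrivial G] (hZ : Subgroup.center G = ⊥) {x u : G}
    (hxu : Gen u x) (hu : u ^ 3 = 1) (hT : ¬ Cj (u, x) (u, x * u))
    (h1 : (x * u) ^ 3 ≠ 1) (h2 : (x * u * u) ^ 3 ≠ 1) : 6 * Nat.card G ≤ np G := by
  have hu3 : u * u * u = 1 := by rw [← hu]; simp [pow_succ]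
  have T02 : ¬ Cj (u, x) (u, x * u * u) := by
    rintro ⟨h, e1, e2⟩
    simp only at e1 e2
    apply hT
    refine ⟨h * h, ?_, ?_⟩
    · calc _ = h * (h * u * h⁻¹) * h⁻¹ := by group
        _ = _ := by rw [e1, e1]
    · calc _ = h * (h * x * h⁻¹) * h⁻¹ := by group
        _ = h * (x * u * u) * h⁻¹ := by rw [e2]
        _ = (h * x * h⁻¹) * (h * u * h⁻¹) * (h * u * h⁻¹) := by group
        _ = x * u * (u * u * u) := by rw [e1, e2]; group
        _ = _ := by rw [hu3]; simp
  have T12 : ¬ Cj (u, x * u) (u, x * u * u) := by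
    rintro ⟨h, e1, e2⟩
    simp only at e1 e2
    apply hT
    refine ⟨h, e1, ?_⟩
    simp only
    have : (h * x * h⁻¹) * (h * u * h⁻¹) = x * u * u := by rw [← e2]; group
    rw [e1] at this
    exact mul_right_cancel this
  have hsep : ∀ a b c d : G, a ^ 3 = 1 → c ^ 3 ≠ 1 → ¬ Cj (a, b) (c, d) := by
    rintro a b c d ha hc ⟨h, e1, e2⟩
    simp only at e1
    apply hc
    rw [← e1, conj_cube, ha]
  have hsep2 : ∀ a b c d : G, b ^ 3 = 1 → d ^ 3 ≠ 1 → ¬ Cj (a, b) (c, d) := by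
    rintro a b c d ha hc ⟨h, e1, e2⟩
    simp only at e2
    apply hc
    rw [← e2, conj_cube, ha]
  have gu1 := gen_mul_right hxu
  have gu2 := gen_mul_right gu1
  refine six_count hZ (u, x) (u, x * u) (u, x * u * u) (x * u, u) (x * u * u, u)
    (x * u, x * u * u) hxu gu1 gu2 gu1.symm gu2.symm ?_ ?_
  · apply gu1.trans
    intro H a b
    have hm := H.mul_mem (H.inv_mem a) b
    simp only [inv_mul_cancel_left] at hm
    exact ⟨hm, a⟩
  · apply pairwise_six (R := Cj) (fun p q h => h.symm)
    · exact hT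
    · exact T02
    · exact hsep _ _ _ _ hu h1
    · exact hsep _ _ _ _ hu h2
    · exact hsep _ _ _ _ hu h1
    · exact T12
    · exact hsep _ _ _ _ hu h1
    · exact hsep _ _ _ _ hu h2
    · exact hsep _ _ _ _ hu h1
    · exact hsep _ _ _ _ hu h1
    · exact hsep _ _ _ _ hu h2
    · exact hsep _ _ _ _ hu h1
    · rintro ⟨h, e1, e2⟩
      exact T12 ⟨h, e2, e1⟩
    · exact hsep2 _ _ _ _ hu h2
    · exact hsep2 _ _ _ _ hu h2

theorem three_mid [Nontrivial G] (hP : commutator G = ⊤) (hZ : Subgroup.center G = ⊥) {x u : G}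
    (hxu : Gen u x) (hu : u ^ 3 = 1) (hT : ¬ Cj (u, x) (u, x * u)) :
    6 * Nat.card G ≤ np G := by
  have hu3 : u * u * u = 1 := by rw [← hu]; simp [pow_succ]
  have gu1 := gen_mul_right hxu
  have gu2 := gen_mul_right gu1
  have shift : ∀ y, ¬ Cj (u, y) (u, y * u) → ¬ Cj (u, y * u) (u, y * u * u) := by
    rintro y hy ⟨h, e1, e2⟩
    simp only at e1 e2
    apply hy
    refine ⟨h, e1, ?_⟩
    simp only
    have : (h * y * h⁻¹) * (h * u * h⁻¹) = y * u * u := by rw [← e2]; group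
    rw [e1] at this
    exact mul_right_cancel this
  have hT1 := shift _ hT
  have hT2 := shift _ hT1
  have e0 : x * u * u * u = x := by rw [mul_assoc, mul_assoc, ← mul_assoc u, hu3, mul_one]
  have no2 : ∀ y, Gen u y → y ^ 3 = 1 → (y * u) ^ 3 ≠ 1 := by
    intro y hy h1 h2
    exact no_333 hP hy.symm hu h1 h2
  by_cases c0 : x ^ 3 = 1
  · have c1 := no2 x hxu c0
    have c2 : (x * u * u) ^ 3 ≠ 1 := by
      intro h
      apply no2 _ gu2 h
      rw [e0, c0]
    exact three_final hZ hxu hu hT c1 c2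
  · by_cases c1 : (x * u) ^ 3 = 1
    · have c2 := no2 _ gu1 c1
      exact three_final hZ gu1 hu hT1 c2 (by rwa [e0])
    · exact three_final hZ gu2 hu hT2 (by rwa [e0]) (by rwa [e0])

theorem three_case [Nontrivial G] (hP : commutator G = ⊤) (hZ : Subgroup.center G = ⊥) {x u : G}
    (hxu : Gen u x) (hu : u ^ 3 = 1) : 6 * Nat.card G ≤ np G := by
  by_contra hcon
  have hall : ∀ v, v ^ 3 = 1 → Gen v x → Cj (v, x) (v, x * v) := by
    intro v hv hg
    by_contra h
    exact hcon (three_mid hP hZ hg hv h)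
  apply seq_case hP (x := x) {v | v ^ 3 = 1 ∧ Gen v x} ⟨u, hu, hxu⟩ (fun v hv => hv.2)
  rintro v ⟨hv, hg⟩
  obtain ⟨h, e1, e2⟩ := hall v hv hg
  simp only at e1 e2
  have hcv : h * v = v * h := by rw [mul_inv_eq_iff_eq_mul] at e1; exact e1
  refine ⟨h, ⟨?_, ?_⟩, hcv, e2⟩
  · apply eq_one_of_gen hZ hg
    · exact (Commute.pow_left (show Commute h v from hcv) 3)
    · have : h ^ 3 * x * (h ^ 3)⁻¹ = x := by
        have hv3 : v * v * v = 1 := by rw [← hv]; simp [pow_succ]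
        calc _ = h * (h * (h * x * h⁻¹) * h⁻¹) * h⁻¹ := by simp only [pow_succ, pow_zero]; group
          _ = h * (h * (x * v) * h⁻¹) * h⁻¹ := by rw [e2]
          _ = h * ((h * x * h⁻¹) * (h * v * h⁻¹)) * h⁻¹ := by group
          _ = h * (x * v * v) * h⁻¹ := by rw [e1, e2]
          _ = (h * x * h⁻¹) * (h * v * h⁻¹) * (h * v * h⁻¹) := by group
          _ = x * (v * v * v) := by rw [e1, e2]; group
          _ = x := by rw [hv3, mul_one]
      rw [mul_inv_eq_iff_eq_mul] at this
      exact this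
  · apply hg.trans
    intro H a b
    refine ⟨?_, b⟩
    have : v = x⁻¹ * (h * x * h⁻¹) := by rw [e2]; group
    rw [this]
    exact H.mul_mem (H.inv_mem b) (H.mul_mem (H.mul_mem a b) (H.inv_mem a))

end perfect2
end GenPairs

namespace GenPairs
set_option linter.unusedSectionVars false
section perfect3
variable {G : Type*} [Group G] [Finite G]

theorem cj_rot [Nontrivial G] (hP : commutator G = ⊤) (hZ : Subgroup.center G = ⊥)
    (hcon : ¬ 6 * Nat.card G ≤ np G) {x y z : G} (hxy : Gen x y) (hz : x * y * z = 1)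
    : ¬ Cj (x, y) (y, z) := by
  rintro ⟨h, e1, e2⟩
  simp only at e1 e2
  apply hcon
  have hz' : z = y⁻¹ * x⁻¹ := by rw [← mul_inv_rev]; exact eq_inv_of_mul_eq_one_right hz
  have e3 : h * z * h⁻¹ = x := by
    calc _ = (h * y * h⁻¹)⁻¹ * (h * x * h⁻¹)⁻¹ := by rw [hz']; group
      _ = x := by rw [e1, e2, hz']; group
  have hc : h ^ 3 = 1 := by
    apply eq_one_of_gen hZ hxy
    · rw [← mul_inv_eq_iff_eq_mul]
      calc _ = h * (h * (h * x * h⁻¹) * h⁻¹) * h⁻¹ := by simp only [pow_succ, pow_zero]; group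
        _ = x := by rw [e1, e2, e3]
    · rw [← mul_inv_eq_iff_eq_mul]
      calc _ = h * (h * (h * y * h⁻¹) * h⁻¹) * h⁻¹ := by simp only [pow_succ, pow_zero]; group
        _ = y := by rw [e2, e3, e1]
  refine three_case hP hZ (x := x) (u := h) ?_ hc
  apply hxy.trans
  intro H a b
  refine ⟨b, ?_⟩
  rw [← e1]
  exact H.mul_mem (H.mul_mem a b) (H.inv_mem a)

theorem sq_of_swap (hZ : Subgroup.center G = ⊥) {x y x' y' h : G} (hxy : Gen x y)
    (e1 : h * x * h⁻¹ = x') (e2 : h * y * h⁻¹ = y')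
    (e3 : h * x' * h⁻¹ = x) (e4 : h * y' * h⁻¹ = y) : h ^ 2 = 1 := by
  apply eq_one_of_gen hZ hxy
  · rw [← mul_inv_eq_iff_eq_mul]
    calc _ = h * (h * x * h⁻¹) * h⁻¹ := by simp only [pow_succ, pow_zero]; group
      _ = x := by rw [e1, e3]
  · rw [← mul_inv_eq_iff_eq_mul]
    calc _ = h * (h * y * h⁻¹) * h⁻¹ := by simp only [pow_succ, pow_zero]; group
      _ = y := by rw [e2, e4]

theorem conj_inv_of {h a b : G} (e : h * a * h⁻¹ = b) : h * a⁻¹ * h⁻¹ = b⁻¹ := by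
  rw [← e]; group

theorem conj_mul_of {h a b c d : G} (e : h * a * h⁻¹ = b) (e' : h * c * h⁻¹ = d) :
    h * (a * c) * h⁻¹ = b * d := by
  rw [← e, ← e']; group

theorem cj_refl1 [Nontrivial G] (hP : commutator G = ⊤) (hZ : Subgroup.center G = ⊥)
    (hcon : ¬ 6 * Nat.card G ≤ np G) {x y : G} (hxy : Gen x y) :
    ¬ Cj (x, y) (y⁻¹, x⁻¹) := by
  rintro ⟨h, e1, e2⟩
  simp only at e1 e2
  apply hcon
  have hc : h ^ 2 = 1 := sq_of_swap hZ hxy e1 e2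
    (by rw [conj_inv_of e2, inv_inv]) (by rw [conj_inv_of e1, inv_inv])
  refine inv_case hP hZ (x := x) (g := h) ?_ hc
  apply hxy.trans
  intro H a b
  refine ⟨a, ?_⟩
  have := H.inv_mem (H.mul_mem (H.mul_mem b a) (H.inv_mem b))
  rw [e1, inv_inv] at this
  exact this

theorem cj_refl2 [Nontrivial G] (hP : commutator G = ⊤) (hZ : Subgroup.center G = ⊥)
    (hcon : ¬ 6 * Nat.card G ≤ np G) {x y : G} (hxy : Gen x y) :
    ¬ Cj (x, y) (x⁻¹, x * y) := by
  rintro ⟨h, e1, e2⟩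
  simp only at e1 e2
  apply hcon
  have hc : h ^ 2 = 1 := sq_of_swap hZ hxy e1 e2
    (by rw [conj_inv_of e1, inv_inv]) (by rw [conj_mul_of e1 e2]; group)
  refine inv_case hP hZ (x := y) (g := h) ?_ hc
  apply hxy.trans
  intro H a b
  refine ⟨?_, a⟩
  have := H.mul_mem (H.mul_mem (H.mul_mem b a) (H.inv_mem b)) (H.inv_mem a)
  rw [e2, mul_inv_cancel_right] at this
  exact this

theorem cj_refl3 [Nontrivial G] (hP : commutator G = ⊤) (hZ : Subgroup.center G = ⊥)
    (hcon : ¬ 6 * Nat.card G ≤ np G) {x y : G} (hxy : Gen x y) :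
    ¬ Cj (x, y) (x * y, y⁻¹) := by
  rintro ⟨h, e1, e2⟩
  simp only at e1 e2
  apply hcon
  have hc : h ^ 2 = 1 := sq_of_swap hZ hxy e1 e2
    (by rw [conj_mul_of e1 e2]; group) (by rw [conj_inv_of e2, inv_inv])
  refine inv_case hP hZ (x := x) (g := h) ?_ hc
  apply hxy.trans
  intro H a b
  refine ⟨a, ?_⟩
  have := H.mul_mem (H.inv_mem a) (H.mul_mem (H.mul_mem b a) (H.inv_mem b))
  rw [e1, inv_mul_cancel_left] at this
  exact this

theorem perfect_six [Nontrivial G] (hP : commutator G = ⊤) (hZ : Subgroup.center G = ⊥)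
    {x y : G} (hxy : Gen x y) : 6 * Nat.card G ≤ np G := by
  by_contra hcon
  obtain ⟨z, hz⟩ : ∃ z, z = y⁻¹ * x⁻¹ := ⟨_, rfl⟩
  have r1 : x * y * z = 1 := by rw [hz]; group
  have r2 : y * z * x = 1 := by rw [hz]; group
  have r3 : z * x * y = 1 := by rw [hz]; group
  have gyz : Gen y z := by
    apply hxy.trans
    intro H a b
    refine ⟨?_, a⟩
    have := H.inv_mem (H.mul_mem a b)
    rwa [hz, show (y * (y⁻¹ * x⁻¹))⁻¹ = x by group] at this
  have gzx : Gen z x := by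
    apply hxy.trans
    intro H a b
    refine ⟨b, ?_⟩
    have := H.inv_mem (H.mul_mem a b)
    rwa [hz, show (y⁻¹ * x⁻¹ * x)⁻¹ = y by group] at this
  have ginv : ∀ {a b : G}, Gen a b → Gen b⁻¹ a⁻¹ := by
    intro a b h
    apply h.trans
    intro H h1 h2
    exact ⟨by simpa using h2, by simpa using h1⟩
  have zi1 : z⁻¹ = x * y := by rw [hz]; group
  have xi1 : x⁻¹ = y * z := by rw [hz]; group
  have yi1 : y⁻¹ = z * x := by rw [hz]; group
  apply hcon
  refine six_count hZ (x, y) (y, z) (z, x) (y⁻¹, x⁻¹) (z⁻¹, y⁻¹) (x⁻¹, z⁻¹) hxy gyz gzx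
    (ginv hxy) (ginv gyz) (ginv gzx) ?_
  apply pairwise_six (R := Cj) (fun p q h => h.symm)
  · exact cj_rot hP hZ hcon hxy r1
  · exact fun h => cj_rot hP hZ hcon gzx r3 h.symm
  · exact cj_refl1 hP hZ hcon hxy
  · rw [zi1]; exact cj_refl3 hP hZ hcon hxy
  · rw [zi1]; exact cj_refl2 hP hZ hcon hxy
  · exact cj_rot hP hZ hcon gyz r2
  · rw [xi1]; exact cj_refl2 hP hZ hcon gyz
  · exact cj_refl1 hP hZ hcon gyz
  · rw [xi1]; exact cj_refl3 hP hZ hcon gyz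
  · rw [yi1]; exact cj_refl3 hP hZ hcon gzx
  · rw [yi1]; exact cj_refl2 hP hZ hcon gzx
  · exact cj_refl1 hP hZ hcon gzx
  · exact fun h => cj_rot hP hZ hcon (ginv gyz) (by rw [hz]; group) h.symm
  · exact cj_rot hP hZ hcon (ginv hxy) (by rw [hz]; group)
  · exact fun h => cj_rot hP hZ hcon (ginv gzx) (by rw [hz]; group) h.symm

end perfect3
end GenPairs

namespace GenPairs
open scoped commutatorElement
set_option linter.unusedSectionVars false
set_option linter.style.haveILetI false
section gaschutz
variable {G : Type*} [Group G] [Finite G] (N : Subgroup G) [N.Normal]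

/-- pairs in `H` above `(a, b)`. -/
def TT (H : Subgroup G) (a b : G ⧸ N) : Set (G × G) :=
  {p | p.1 ∈ H ∧ p.2 ∈ H ∧ (p.1 : G ⧸ N) = a ∧ (p.2 : G ⧸ N) = b}

/-- pairs generating `H` above `(a, b)`. -/
def LL (H : Subgroup G) (a b : G ⧸ N) : Set (G × G) :=
  {p | Subgroup.closure {p.1, p.2} = H ∧ (p.1 : G ⧸ N) = a ∧ (p.2 : G ⧸ N) = b}

theorem TT_le (H : Subgroup G) (hH : ∀ q : G ⧸ N, ∃ h ∈ H, (h : G ⧸ N) = q) (a b a' b' : G ⧸ N) :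
    Nat.card (TT N H a b) ≤ Nat.card (TT N H a' b') := by
  obtain ⟨h1, hh1, e1⟩ := hH (a' * a⁻¹)
  obtain ⟨h2, hh2, e2⟩ := hH (b' * b⁻¹)
  let F : TT N H a b → TT N H a' b' := fun p => ⟨(h1 * p.1.1, h2 * p.1.2),
    H.mul_mem hh1 p.2.1, H.mul_mem hh2 p.2.2.1,
    by rw [QuotientGroup.mk_mul, e1, p.2.2.2.1]; group,
    by rw [QuotientGroup.mk_mul, e2, p.2.2.2.2]; group⟩
  apply Nat.card_le_card_of_injective F
  rintro ⟨⟨x, y⟩, hp⟩ ⟨⟨x', y'⟩, hp'⟩ h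
  have h' : (h1 * x, h2 * y) = (h1 * x', h2 * y') := congrArg Subtype.val h
  have i1 := mul_left_cancel (congrArg Prod.fst h')
  have i2 := mul_left_cancel (congrArg Prod.snd h')
  subst i1 i2
  rfl

theorem TT_sum (H : Subgroup G) (a b : G ⧸ N) :
    letI := Fintype.ofFinite (Subgroup G)
    letI := Classical.decPred (fun K : Subgroup G => K ≤ H)
    Nat.card (TT N H a b) = ∑ K : Subgroup G with K ≤ H, Nat.card (LL N K a b) := by
  classical
  letI := Fintype.ofFinite (Subgroup G)
  letI := Fintype.ofFinite G
  have e1 : Nat.card (TT N H a b) = (Finset.univ.filter (· ∈ TT N H a b)).card := by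
    rw [Nat.card_eq_fintype_card, Fintype.card_subtype]
  rw [e1, Finset.card_eq_sum_card_fiberwise (f := fun p : G × G => Subgroup.closure {p.1, p.2})
    (t := Finset.univ.filter (fun K : Subgroup G => K ≤ H))]
  · convert Finset.sum_congr rfl ?_
    intro K hK
    rw [Finset.mem_filter] at hK
    rw [Nat.card_eq_fintype_card, Fintype.card_subtype, Finset.filter_filter]
    congr 1
    ext p
    simp only [Finset.mem_filter, Finset.mem_univ, true_and, TT, LL, Set.mem_setOf_eq]
    constructor
    · rintro ⟨⟨h1, h2, h3, h4⟩, h5⟩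
      exact ⟨h5, h3, h4⟩
    · rintro ⟨h5, h3, h4⟩
      refine ⟨⟨hK.2 ?_, hK.2 ?_, h3, h4⟩, h5⟩
      · rw [← h5]; exact Subgroup.subset_closure (by simp)
      · rw [← h5]; exact Subgroup.subset_closure (by simp)
  · intro p hp
    simp only [Finset.coe_filter, Finset.mem_univ, true_and, TT, Set.mem_setOf_eq] at hp ⊢
    rw [Subgroup.closure_le]
    rintro z (rfl | rfl)
    · exact hp.1
    · exact hp.2.1

theorem gaschutz_aux (n : ℕ) : ∀ (H : Subgroup G), Nat.card H = n → ∀ (a b a' b' : G ⧸ N),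
    Gen a b → Gen a' b' → Nat.card (LL N H a b) = Nat.card (LL N H a' b') := by
  classical
  induction n using Nat.strong_induction_on with
  | _ n ih =>
  intro H hn a b a' b' hab hab'
  by_cases hH : ∀ q : G ⧸ N, ∃ h ∈ H, (h : G ⧸ N) = q
  · have h1 := TT_sum N H a b
    have h2 := TT_sum N H a' b'
    have h3 : Nat.card (TT N H a b) = Nat.card (TT N H a' b') :=
      le_antisymm (TT_le N H hH _ _ _ _) (TT_le N H hH _ _ _ _)
    rw [h1, h2] at h3
    have hm : H ∈ (@Finset.filter _ (fun K : Subgroup G => K ≤ H)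
      (Classical.decPred _) (@Finset.univ _ (Fintype.ofFinite (Subgroup G)))) := by
      simp
    rw [← Finset.add_sum_erase _ _ hm, ← Finset.add_sum_erase _ _ hm] at h3
    rw [Finset.sum_congr rfl (g := fun K => Nat.card (LL N K a' b'))] at h3
    · exact Nat.add_right_cancel h3
    · intro K hK
      rw [Finset.mem_erase, Finset.mem_filter] at hK
      refine ih (Nat.card K) ?_ K rfl a b a' b' hab hab'
      rw [← hn]
      by_contra hc
      exact hK.1 (Subgroup.eq_of_le_of_card_ge hK.2.2 (not_lt.1 hc))
  · have hz : ∀ a b : G ⧸ N, Gen a b → Nat.card (LL N H a b) = 0 := by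
      intro a b hab
      rw [Nat.card_eq_zero]
      left
      constructor
      rintro ⟨⟨x, y⟩, h1, h2, h3⟩
      simp only at h1 h2 h3
      apply hH
      rw [gen_iff] at hab
      have := hab (H.map (QuotientGroup.mk' N))
        ⟨x, by rw [← h1]; exact Subgroup.subset_closure (by simp), h2⟩
        ⟨y, by rw [← h1]; exact Subgroup.subset_closure (by simp), h3⟩
      intro q
      have hq : q ∈ H.map (QuotientGroup.mk' N) := by rw [this]; trivial
      obtain ⟨h, hh, e⟩ := hq
      exact ⟨h, hh, e⟩
    rw [hz a b hab, hz a' b' hab']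

theorem gaschutz {a b a' b' : G ⧸ N} (hab : Gen a b) (hab' : Gen a' b') :
    Nat.card (LL N ⊤ a b) = Nat.card (LL N ⊤ a' b') :=
  gaschutz_aux N _ ⊤ rfl a b a' b' hab hab'

theorem lift_exists {x y : G} (hxy : Gen x y) {a b : G ⧸ N} (hab : Gen a b) :
    ∃ p : G × G, Gen p.1 p.2 ∧ (p.1 : G ⧸ N) = a ∧ (p.2 : G ⧸ N) = b := by
  have h := gaschutz N hab (hxy.map (QuotientGroup.mk' N) (QuotientGroup.mk'_surjective N))
  have : 0 < Nat.card (LL N ⊤ (QuotientGroup.mk' N x) (QuotientGroup.mk' N y)) := by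
    have : Nonempty (LL N ⊤ (QuotientGroup.mk' N x) (QuotientGroup.mk' N y)) :=
      ⟨⟨(x, y), hxy, rfl, rfl⟩⟩
    exact Nat.card_pos
  rw [← h] at this
  obtain ⟨p, hp⟩ := (Nat.card_pos_iff.1 this).1
  exact ⟨p, hp⟩

theorem np_eq {a b : G ⧸ N} (hab : Gen a b) :
    np G = np (G ⧸ N) * Nat.card (LL N ⊤ a b) := by
  classical
  letI := Fintype.ofFinite G
  letI := Fintype.ofFinite (G ⧸ N)
  have E1 : np G = (Finset.univ.filter (fun p : G × G => Gen p.1 p.2)).card := by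
    unfold np
    rw [Nat.card_eq_fintype_card]
    exact Fintype.card_subtype _
  have E2 : np (G ⧸ N) =
      (Finset.univ.filter (fun p : (G ⧸ N) × (G ⧸ N) => Gen p.1 p.2)).card := by
    unfold np
    rw [Nat.card_eq_fintype_card]
    exact Fintype.card_subtype _
  rw [E1, E2, Finset.card_eq_sum_card_fiberwise (f := fun p : G × G => ((p.1 : G ⧸ N), (p.2 : G ⧸ N)))
    (t := Finset.univ.filter (fun p : (G ⧸ N) × (G ⧸ N) => Gen p.1 p.2)),
    Finset.sum_const_nat (m := Nat.card (LL N ⊤ a b))]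
  · rintro ⟨c, d⟩ hp
    simp only [Finset.mem_filter, Finset.mem_univ, true_and] at hp
    rw [gaschutz N hab hp, Nat.card_eq_fintype_card, Fintype.card_subtype, Finset.filter_filter]
    congr 1
    ext p
    simp only [Finset.mem_filter, Finset.mem_univ, true_and, LL, Set.mem_setOf_eq, Gen, Prod.mk.injEq]
  · intro p hp
    simp only [Finset.coe_filter, Finset.mem_univ, true_and, Set.mem_setOf_eq] at hp ⊢
    exact hp.map (QuotientGroup.mk' N) (QuotientGroup.mk'_surjective N)

end gaschutz

section bounds
variable {G : Type*} [Group G] [Finite G]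

theorem np_ge_ab {x y : G} (hxy : Gen x y) :
    np (G ⧸ commutator G) * Nat.card (G ⧸ Subgroup.center G) ≤ np G := by
  let ι := {p : (G ⧸ commutator G) × (G ⧸ commutator G) | Gen p.1 p.2}
  have hl : ∀ i : ι, ∃ p : G × G, Gen p.1 p.2 ∧ (p.1 : G ⧸ commutator G) = i.1.1 ∧
      (p.2 : G ⧸ commutator G) = i.1.2 := fun i => lift_exists _ hxy i.2
  choose f h1 h2 h3 using hl
  refine conj_count (ι := ι) {p : G × G | Gen p.1 p.2} f (fun i g => (h1 i).conj g) h1 ?_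
  rintro i j ⟨g, e1, e2⟩
  have hc : ∀ a b : G, ((a * b * a⁻¹ : G) : G ⧸ commutator G) = b := by
    intro a b
    rw [eq_comm, QuotientGroup.eq]
    have : b⁻¹ * (a * b * a⁻¹) = ⁅b⁻¹, a⁆ := by rw [commutatorElement_def]; group
    rw [this]
    exact Subgroup.commutator_mem_commutator (Subgroup.mem_top _) (Subgroup.mem_top _)
  apply Subtype.ext
  apply Prod.ext
  · rw [← h2, ← h2, ← e1, hc]
  · rw [← h3, ← h3, ← e2, hc]

/-- central part of the derived group -/
theorem np_ge_frat (F : Subgroup G) [F.Normal] (hF : F ≤ Subgroup.center G)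
    (hF' : F ≤ commutator G) : np (G ⧸ F) * (Nat.card F * Nat.card F) ≤ np G := by
  have hgen : ∀ x y : G, Gen (x : G ⧸ F) (y : G ⧸ F) → Gen x y := by
    intro x y h
    rw [gen_iff] at *
    intro H hx hy
    have hm := h (H.map (QuotientGroup.mk' F)) ⟨x, hx, rfl⟩ ⟨y, hy, rfl⟩
    have hdec : ∀ g : G, ∃ k ∈ H, ∃ f ∈ Subgroup.center G, f ∈ F ∧ g = k * f := by
      intro g
      have : (g : G ⧸ F) ∈ H.map (QuotientGroup.mk' F) := by rw [hm]; trivial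
      obtain ⟨k, hk, e⟩ := this
      have e' : k⁻¹ * g ∈ F := QuotientGroup.eq.1 e
      exact ⟨k, hk, k⁻¹ * g, hF e', e', by group⟩
    have hcom : commutator G ≤ H := by
      rw [commutator_def, Subgroup.commutator_le]
      intro a _ b _
      obtain ⟨k, hk, f, hf, -, rfl⟩ := hdec a
      obtain ⟨l, hl, f', hf', -, rfl⟩ := hdec b
      rw [Subgroup.mem_center_iff] at hf hf'
      have : ⁅k * f, l * f'⁆ = ⁅k, l⁆ := by
        simp only [commutatorElement_def, mul_inv_rev]
        have c1 : k * f * (l * f') = k * l * f * f' := by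
          rw [show k * f * (l * f') = k * (f * l) * f' by group, ← hf l]; group
        have c2 : f⁻¹ * k⁻¹ = k⁻¹ * f⁻¹ := by rw [← mul_inv_rev, hf, mul_inv_rev]
        have c3 : f'⁻¹ * l⁻¹ = l⁻¹ * f'⁻¹ := by rw [← mul_inv_rev, ← mul_inv_rev, hf']
        have c4 : f' * k⁻¹ = k⁻¹ * f' := (hf' k⁻¹).symm
        have c5 : f * k⁻¹ = k⁻¹ * f := (hf k⁻¹).symm
        have c6 : f * l⁻¹ = l⁻¹ * f := (hf l⁻¹).symm
        have c7 : f' * f⁻¹ = f⁻¹ * f' := (hf' f⁻¹).symm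
        calc _ = k * l * f * (f' * (f⁻¹ * k⁻¹)) * (f'⁻¹ * l⁻¹) := by rw [c1]; group
          _ = k * l * f * (f' * k⁻¹) * f⁻¹ * (f'⁻¹ * l⁻¹) := by rw [c2]; group
          _ = k * l * (f * k⁻¹) * (f' * f⁻¹) * (f'⁻¹ * l⁻¹) := by rw [c4]; group
          _ = _ := by rw [c5, c7]; group
      rw [this]
      exact H.mul_mem (H.mul_mem (H.mul_mem hk hl) (H.inv_mem hk)) (H.inv_mem hl)
    rw [eq_top_iff]
    intro g _
    obtain ⟨k, hk, f, -, hf, rfl⟩ := hdec g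
    exact H.mul_mem hk (hcom (hF' hf))
  unfold np
  rw [← Nat.card_prod, ← Nat.card_prod]
  let Φ : {p : (G ⧸ F) × (G ⧸ F) | Gen p.1 p.2} × (F × F) → {p : G × G | Gen p.1 p.2} :=
    fun q => ⟨(q.1.1.1.out * q.2.1, q.1.1.2.out * q.2.2), by
      apply hgen
      have h1 : ((q.1.1.1.out * q.2.1 : G) : G ⧸ F) = q.1.1.1 := by
        rw [QuotientGroup.mk_mul_of_mem _ q.2.1.2, QuotientGroup.out_eq']
      have h2 : ((q.1.1.2.out * q.2.2 : G) : G ⧸ F) = q.1.1.2 := by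
        rw [QuotientGroup.mk_mul_of_mem _ q.2.2.2, QuotientGroup.out_eq']
      simp only
      rw [h1, h2]
      exact q.1.2⟩
  apply Nat.card_le_card_of_injective Φ
  rintro ⟨⟨⟨a, b⟩, h⟩, f1, f2⟩ ⟨⟨⟨a', b'⟩, h'⟩, f1', f2'⟩ e
  simp only [Φ, Subtype.mk.injEq, Prod.mk.injEq] at e
  have ha : a = a' := by
    have := congrArg (QuotientGroup.mk : G → G ⧸ F) e.1
    rwa [QuotientGroup.mk_mul_of_mem _ f1.2, QuotientGroup.mk_mul_of_mem _ f1'.2,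
      QuotientGroup.out_eq', QuotientGroup.out_eq'] at this
  have hb : b = b' := by
    have := congrArg (QuotientGroup.mk : G → G ⧸ F) e.2
    rwa [QuotientGroup.mk_mul_of_mem _ f2.2, QuotientGroup.mk_mul_of_mem _ f2'.2,
      QuotientGroup.out_eq', QuotientGroup.out_eq'] at this
  subst ha hb
  simp only [mul_right_inj, SetLike.coe_eq_coe] at e
  simp [e.1, e.2]

end bounds
end GenPairs

namespace GenPairs
set_option linter.unusedSectionVars false

theorem np_le_of_equiv {G H : Type*} [Group G] [Group H] [Finite G] (e : G ≃* H) :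
    np H ≤ np G := by
  unfold np
  let Φ : {p : H × H | Gen p.1 p.2} → {p : G × G | Gen p.1 p.2} :=
    fun q => ⟨(e.symm q.1.1, e.symm q.1.2), Gen.map q.2 e.symm.toMonoidHom e.symm.surjective⟩
  apply Nat.card_le_card_of_injective Φ
  rintro ⟨⟨a, b⟩, h⟩ ⟨⟨a', b'⟩, h'⟩ hh
  have h1 := congrArg Subtype.val hh
  have h2 := e.symm.injective (congrArg Prod.fst h1)
  have h3 := e.symm.injective (congrArg Prod.snd h1)
  simp only at h2 h3
  subst h2 h3
  rfl

theorem gen_zmod {n m : ℕ} [NeZero n] [NeZero m] (s : (ZMod n)ˣ) (i : ZMod m) (a : (ZMod m)ˣ)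
    (l : ZMod n) : Gen (Multiplicative.ofAdd ((s : ZMod n), i))
      (Multiplicative.ofAdd (l.val • (s : ZMod n), (a : ZMod m) + l.val • i)) := by
  rw [gen_iff]
  intro H hx hy
  have hm : ∀ (u : ZMod n × ZMod m) (k : ℕ), Multiplicative.ofAdd u ∈ H →
      Multiplicative.ofAdd (k • u) ∈ H := by
    intro u k hu
    rw [ofAdd_nsmul]
    exact H.pow_mem hu k
  have hs : ∀ (u v : ZMod n × ZMod m), Multiplicative.ofAdd u ∈ H → Multiplicative.ofAdd v ∈ H →
      Multiplicative.ofAdd (u - v) ∈ H := by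
    intro u v hu hv
    rw [ofAdd_sub]
    exact H.div_mem hu hv
  have h1 : Multiplicative.ofAdd ((0 : ZMod n), (a : ZMod m)) ∈ H := by
    have := hs _ _ hy (hm _ l.val hx)
    convert this using 2
    ext <;> simp
  have h2 : ∀ j : ZMod m, Multiplicative.ofAdd ((0 : ZMod n), j) ∈ H := by
    intro j
    have := hm _ (j * (a⁻¹ : (ZMod m)ˣ)).val h1
    convert this using 2
    ext <;> simp
  have h3 : Multiplicative.ofAdd ((s : ZMod n), (0 : ZMod m)) ∈ H := by
    have := hs _ _ hx (h2 i)
    convert this using 2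
    ext <;> simp
  rw [eq_top_iff]
  rintro u -
  obtain ⟨p, q⟩ := u
  have h4 : Multiplicative.ofAdd ((-p : ZMod n), (0 : ZMod m)) ∈ H := by
    have := hm _ (-p * (s⁻¹ : (ZMod n)ˣ)).val h3
    convert this using 2
    ext <;> simp
  have := hs _ _ (h2 q) h4
  have e : ((0 : ZMod n), q) - (-p, (0 : ZMod m)) = (p, q) := by ext <;> simp
  rw [e] at this
  exact this

theorem card_nonunit (n : ℕ) [NeZero n] :
    Nat.totient n + Nat.card {l : ZMod n // ¬ IsUnit l} = n := by
  classical
  have h1 : Nat.card {l : ZMod n // IsUnit l} = Nat.totient n := by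
    rw [← ZMod.card_units_eq_totient, ← Nat.card_eq_fintype_card]
    refine (Nat.card_congr (Equiv.ofBijective (fun u : (ZMod n)ˣ => (⟨u, u.isUnit⟩ : {l : ZMod n // IsUnit l})) ⟨?_, ?_⟩)).symm
    · intro u v h
      exact Units.ext (congrArg Subtype.val h)
    · rintro ⟨l, u, rfl⟩
      exact ⟨u, rfl⟩
  rw [← h1, ← Nat.card_sum, Nat.card_congr (Equiv.sumCompl (fun l : ZMod n => IsUnit l))]
  simp

theorem np_zmod (n m : ℕ) [NeZero n] [NeZero m] :
    Nat.totient n * (m * Nat.totient m) * (n + (n - Nat.totient n)) ≤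
      np (Multiplicative (ZMod n × ZMod m)) := by
  have hc : n - Nat.totient n = Nat.card {l : ZMod n // ¬ IsUnit l} := by
    have := card_nonunit n
    omega
  let f : (ZMod n)ˣ × ZMod m × (ZMod m)ˣ → ZMod n → 
      Multiplicative (ZMod n × ZMod m) × Multiplicative (ZMod n × ZMod m) := fun q l =>
    (Multiplicative.ofAdd ((q.1 : ZMod n), q.2.1),
      Multiplicative.ofAdd (l.val • (q.1 : ZMod n), (q.2.2 : ZMod m) + l.val • q.2.1))
  have hf : ∀ q l q' l', f q l = f q' l' → q = q' ∧ l = l' := by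
    rintro ⟨s, i, a⟩ l ⟨s', i', a'⟩ l' h
    have h1 : ((s : ZMod n), i) = ((s' : ZMod n), i') := congrArg Prod.fst h
    have h2 : (l.val • (s : ZMod n), (a : ZMod m) + l.val • i) =
      (l'.val • (s' : ZMod n), (a' : ZMod m) + l'.val • i') := congrArg Prod.snd h
    rw [Prod.mk.injEq] at h1 h2
    obtain ⟨h1, rfl⟩ := h1
    have h1 := Units.ext h1
    subst h1
    obtain ⟨h2, h3⟩ := h2
    have : l = l' := by
      simpa using h2
    subst this
    have h3 := Units.ext (add_right_cancel h3)
    subst h3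
    simp
  let Φ : ((ZMod n)ˣ × ZMod m × (ZMod m)ˣ) × (ZMod n ⊕ {l : ZMod n // ¬ IsUnit l}) →
      {p : Multiplicative (ZMod n × ZMod m) × Multiplicative (ZMod n × ZMod m) | Gen p.1 p.2} :=
    fun q => match q with
    | (q, Sum.inl l) => ⟨f q l, gen_zmod _ _ _ _⟩
    | (q, Sum.inr l) => ⟨(f q l.1).swap, (gen_zmod _ _ _ _).symm⟩
  have key : ∀ q l q' l', f q l = (f q' l').swap → IsUnit l' := by
    rintro ⟨s, i, a⟩ l ⟨s', i', a'⟩ l' h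
    have h1 : ((s : ZMod n), i) = (l'.val • (s' : ZMod n), (a' : ZMod m) + l'.val • i') :=
      congrArg Prod.fst h
    rw [Prod.mk.injEq] at h1
    have h2 : (s : ZMod n) = l' * s' := by simpa using h1.1
    have : IsUnit (l' * (s' : ZMod n)) := by rw [← h2]; exact s.isUnit
    exact isUnit_of_mul_isUnit_left this
  have hΦ : Function.Injective Φ := by
    rintro ⟨q, l | ⟨l, hl⟩⟩ ⟨q', l' | ⟨l', hl'⟩⟩ h
    · have h : f q l = f q' l' := congrArg Subtype.val h
      obtain ⟨rfl, rfl⟩ := hf _ _ _ _ h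
      rfl
    · have h : f q l = (f q' l').swap := congrArg Subtype.val h
      exact absurd (key _ _ _ _ h) hl'
    · have h : (f q l).swap = f q' l' := congrArg Subtype.val h
      exact absurd (key _ _ _ _ h.symm) hl
    · have h : (f q l).swap = (f q' l').swap := congrArg Subtype.val h
      obtain ⟨rfl, rfl⟩ := hf _ _ _ _ (Prod.swap_injective h)
      rfl
  have := Nat.card_le_card_of_injective Φ hΦ
  rw [Nat.card_prod, Nat.card_prod, Nat.card_prod, Nat.card_sum, ← hc] at this
  refine le_trans (le_of_eq ?_) this
  simp [ZMod.card_units_eq_totient]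

end GenPairs

namespace GenPairs
set_option linter.unusedSectionVars false
section ab
variable {A : Type*} [CommGroup A] [Finite A]

theorem reduce_step {x y : A} (hxy : Gen x y) (hd : ¬ Disjoint (Subgroup.zpowers x) (Subgroup.zpowers y)) :
    ∃ x1 y1 : A, Gen x1 y1 ∧ orderOf y1 < orderOf y := by
  classical
  rw [disjoint_iff, Subgroup.eq_bot_iff_forall] at hd
  push Not at hd
  obtain ⟨z, ⟨hz1, hz2⟩, hz⟩ := hd
  obtain ⟨i, hi⟩ := Subgroup.mem_zpowers_iff.1 hz1
  obtain ⟨b, hb, hb2⟩ : ∃ b : ℕ, b < orderOf y ∧ y ^ b = z := by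
    have := (mem_zpowers_iff_mem_range_orderOf).1 hz2
    simpa using this
  have hb0 : 0 < b := by
    rcases Nat.eq_zero_or_pos b with rfl | h
    · simp at hb2; exact absurd hb2.symm hz
    · exact h
  obtain ⟨i', hi'⟩ := Int.gcd_dvd_left i b
  obtain ⟨b', hb'⟩ := Int.gcd_dvd_right i b
  have hd0 : 0 < Int.gcd i b := Int.gcd_pos_of_ne_zero_right _ (by omega)
  have hbez := Int.gcd_eq_gcd_ab i b
  set d := Int.gcd i b with hdd
  set t := Int.gcdA i b
  set s := Int.gcdB i b
  have hbz : b' * s + i' * t = 1 := by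
    have : (d : ℤ) * (b' * s + i' * t) = d * 1 := by
      calc (d : ℤ) * (b' * s + i' * t) = (d * i') * t + (d * b') * s := by ring
        _ = i * t + b * s := by rw [← hi', ← hb']
        _ = d * 1 := by rw [← hbez, mul_one]
    exact mul_left_cancel₀ (by exact_mod_cast hd0.ne') this
  have hy : (y ^ b' * x ^ (-i')) ^ s * (y ^ t * x ^ s) ^ i' = y := by
    calc _ = y ^ (b' * s + t * i') * x ^ (-i' * s + s * i') := by
          rw [mul_zpow, mul_zpow, zpow_add, zpow_add, zpow_mul, zpow_mul, zpow_mul x, zpow_mul x] <;> ac_rfl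
      _ = y := by rw [mul_comm t, hbz]; ring_nf; simp
  have hx : (y ^ b' * x ^ (-i')) ^ (-t) * (y ^ t * x ^ s) ^ b' = x := by
    calc _ = y ^ (b' * (-t) + t * b') * x ^ (-i' * (-t) + s * b') := by
          rw [mul_zpow, mul_zpow, zpow_add, zpow_add, zpow_mul, zpow_mul, zpow_mul x, zpow_mul x] <;> ac_rfl
      _ = x := by
        rw [show -i' * (-t) + s * b' = b' * s + i' * t by ring, hbz]; ring_nf; simp
  refine ⟨y ^ t * x ^ s, y ^ b' * x ^ (-i'), ?_, ?_⟩
  · refine hxy.trans ?_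
    intro H h1 h2
    constructor
    · rw [← hx]; exact H.mul_mem (H.zpow_mem h2 _) (H.zpow_mem h1 _)
    · rw [← hy]; exact H.mul_mem (H.zpow_mem h2 _) (H.zpow_mem h1 _)
  · refine lt_of_le_of_lt ?_ hb
    have h1 : (y ^ b' * x ^ (-i')) ^ (d : ℤ) = 1 := by
      rw [mul_zpow, ← zpow_mul, ← zpow_mul, mul_comm b', ← hb', show -i' * (d : ℤ) = -(d * i') by ring, ← hi',
        zpow_neg, hi, zpow_natCast, hb2, mul_inv_cancel]
    rw [zpow_natCast] at h1
    have h2 := orderOf_le_of_pow_eq_one hd0 h1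
    have h3 : d ∣ b := by exact_mod_cast Int.gcd_dvd_right i b
    exact h2.trans (Nat.le_of_dvd hb0 h3)

theorem exists_disjoint {x y : A} (hxy : Gen x y) : ∃ u v : A, Gen u v ∧
    Disjoint (Subgroup.zpowers u) (Subgroup.zpowers v) ∧ orderOf v ≤ orderOf u := by
  classical
  have hex : ∃ n, ∃ u v : A, Gen u v ∧ orderOf v = n := ⟨_, x, y, hxy, rfl⟩
  obtain ⟨u, v, huv, hn⟩ := Nat.find_spec hex
  have hmin : ∀ u' v' : A, Gen u' v' → orderOf v ≤ orderOf v' := by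
    intro u' v' h
    rw [hn]
    exact Nat.find_min' hex ⟨u', v', h, rfl⟩
  refine ⟨u, v, huv, ?_, hmin _ _ huv.symm⟩
  by_contra hc
  obtain ⟨x1, y1, h1, h2⟩ := reduce_step huv hc
  exact absurd (hmin _ _ h1) (not_le.2 h2)

theorem ab_structure {x y : A} (hxy : Gen x y) : ∃ n m : ℕ, 0 < m ∧ m ≤ n ∧
    Nonempty (A ≃* Multiplicative (ZMod n × ZMod m)) := by
  obtain ⟨u, v, huv, hd, hle⟩ := exists_disjoint hxy
  refine ⟨orderOf u, orderOf v, orderOf_pos v, hle, ?_⟩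
  have hbij : Function.Bijective
      ((Subgroup.zpowers u).subtype.coprod (Subgroup.zpowers v).subtype) := by
    constructor
    · rw [injective_iff_map_eq_one]
      rintro ⟨⟨a, ha⟩, ⟨b, hb⟩⟩ h
      have h : a * b = 1 := h
      have hab : a = b⁻¹ := eq_inv_of_mul_eq_one_left h
      have h1 : a ∈ Subgroup.zpowers v := by rw [hab]; exact Subgroup.inv_mem _ hb
      have h2 := Subgroup.disjoint_def.1 hd ha h1
      subst h2
      simp at hab
      subst hab
      rfl
    · rw [← MonoidHom.range_eq_top]
      rw [gen_iff] at huv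
      apply huv
      · exact ⟨(⟨u, Subgroup.mem_zpowers u⟩, 1), by simp⟩
      · exact ⟨(1, ⟨v, Subgroup.mem_zpowers v⟩), by simp⟩
  have e1 := MulEquiv.ofBijective _ hbij
  have e2 := zmodCyclicMulEquiv (G := Subgroup.zpowers u) inferInstance
  have e3 := zmodCyclicMulEquiv (G := Subgroup.zpowers v) inferInstance
  rw [Nat.card_zpowers] at e2 e3
  exact ⟨e1.symm.trans ((e2.symm.prodCongr e3.symm).trans (MulEquiv.prodMultiplicative _ _).symm)⟩

theorem tot2 {n : ℕ} (h3 : 3 ∣ n) (hn : 0 < n) (h : Nat.totient n = 2) : n = 3 ∨ n = 6 := by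
  obtain ⟨k, rfl⟩ := h3
  by_cases hk : 3 ∣ k
  · obtain ⟨j, rfl⟩ := hk
    have h9 : Nat.totient 9 ∣ Nat.totient (3 * (3 * j)) := Nat.totient_dvd_of_dvd ⟨j, by ring⟩
    rw [h, show Nat.totient 9 = 6 by decide] at h9
    omega
  · have hc : Nat.Coprime 3 k := (Nat.Prime.coprime_iff_not_dvd (by norm_num)).2 hk
    rw [Nat.totient_mul hc, show Nat.totient 3 = 2 by decide] at h
    have : Nat.totient k = 1 := by omega
    rw [Nat.totient_eq_one_iff] at this
    omega

theorem ab_noncyclic {x y : A} (hxy : Gen x y) (hnc : ¬ IsCyclic A)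
    (hepi : ¬ ∃ f : A →* Multiplicative (ZMod 2 × ZMod 2), Function.Surjective f) :
    4 * Nat.card A ≤ np A ∧ (6 * Nat.card A ≤ np A ∨
      Nonempty (A ≃* Multiplicative (ZMod 3 × ZMod 3))) := by
  obtain ⟨n, m, hm, hmn, ⟨e⟩⟩ := ab_structure hxy
  have : NeZero m := ⟨hm.ne'⟩
  have : NeZero n := ⟨by omega⟩
  have hcard : Nat.card A = n * m := by
    rw [Nat.card_congr e.toEquiv, Nat.card_congr (Multiplicative.toAdd), Nat.card_prod]; simp
  have hnp := (np_zmod n m).trans (np_le_of_equiv e)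
  have hcop : ¬ Nat.Coprime n m := by
    intro hc
    apply hnc
    have e2 := (ZMod.chineseRemainder hc).symm.toAddEquiv
    have e3 := e.trans (AddEquiv.toMultiplicative e2)
    exact isCyclic_of_surjective e3.symm e3.symm.surjective
  have heven : ¬ (2 ∣ n ∧ 2 ∣ m) := by
    rintro ⟨h1, h2⟩
    apply hepi
    let f1 := (ZMod.castHom h1 (ZMod 2)).toAddMonoidHom
    let f2 := (ZMod.castHom h2 (ZMod 2)).toAddMonoidHom
    refine ⟨(AddMonoidHom.toMultiplicative (f1.prodMap f2)).comp e.toMonoidHom, ?_⟩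
    have : Function.Surjective (f1.prodMap f2) :=
      Function.Surjective.prodMap (ZMod.castHom_surjective h1) (ZMod.castHom_surjective h2)
    exact Function.Surjective.comp (g := (AddMonoidHom.toMultiplicative (f1.prodMap f2))) this
      e.surjective
  obtain ⟨p, hp, hpn, hpm⟩ := Nat.Prime.not_coprime_iff_dvd.1 hcop
  have hp2 : p ≠ 2 := by rintro rfl; exact heven ⟨hpn, hpm⟩
  have hp3 : 3 ≤ p := by have := hp.two_le; omega
  have hn3 : 3 ≤ n := hp3.trans (Nat.le_of_dvd (by omega) hpn)
  have hm3 : 3 ≤ m := hp3.trans (Nat.le_of_dvd (by omega) hpm)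
  obtain ⟨s, hs⟩ := Nat.totient_even (n := n) (by omega)
  obtain ⟨t, ht⟩ := Nat.totient_even (n := m) (by omega)
  have hs0 := Nat.totient_pos.2 (show 0 < n by omega)
  have ht0 := Nat.totient_pos.2 (show 0 < m by omega)
  have hbig : (Nat.totient n * Nat.totient m) * (n * m) ≤ np A := by
    refine le_trans ?_ hnp
    calc _ = Nat.totient n * (m * Nat.totient m) * n := by ring
      _ ≤ _ := Nat.mul_le_mul_left _ (by omega)
  rw [hcard]
  have h4 : 4 ≤ Nat.totient n * Nat.totient m := by
    calc 4 = 2 * 2 := rfl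
      _ ≤ _ := Nat.mul_le_mul (by omega) (by omega)
  refine ⟨(Nat.mul_le_mul_right _ h4).trans hbig, ?_⟩
  by_cases h8 : 6 ≤ Nat.totient n * Nat.totient m
  · exact Or.inl ((Nat.mul_le_mul_right _ h8).trans hbig)
  have hn2 : Nat.totient n = 2 := by
    by_contra hc
    apply h8
    calc 6 ≤ 4 * 2 := by norm_num
      _ ≤ _ := Nat.mul_le_mul (by omega) (by omega)
  have hm2 : Nat.totient m = 2 := by
    by_contra hc
    apply h8
    calc 6 ≤ 2 * 4 := by norm_num
      _ ≤ _ := Nat.mul_le_mul (by omega) (by omega)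
  have hp3' : p = 3 := by
    have := Nat.totient_dvd_of_dvd hpn
    rw [hn2, Nat.totient_prime hp] at this
    have := Nat.le_of_dvd (by norm_num) this
    omega
  subst hp3'
  rcases tot2 hpn (by omega) hn2 with rfl | rfl <;> rcases tot2 hpm (by omega) hm2 with rfl | rfl
  · exact Or.inr ⟨e⟩
  · omega
  · left
    rw [hn2, hm2] at hnp
    omega
  · omega

theorem ab_cyclic (hc : IsCyclic A) :
    (4 ≤ Nat.card A → 3 * Nat.card A ≤ np A) ∧ (Nat.card A = 3 → 8 ≤ np A) ∧
      (Nat.card A = 2 → 3 ≤ np A) ∧ Nat.card A ≤ np A := by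
  have e := (zmodCyclicMulEquiv hc).symm
  have hpos : 0 < Nat.card A := Nat.card_pos
  generalize Nat.card A = n at *
  have : NeZero n := ⟨by omega⟩
  let e2 : ZMod n ≃+ ZMod n × ZMod 1 := AddEquiv.prodUnique.symm
  have hnp := (np_zmod n 1).trans (np_le_of_equiv (e.trans (AddEquiv.toMultiplicative e2)))
  rw [Nat.totient_one, mul_one, mul_one] at hnp
  have hs0 := Nat.totient_pos.2 hpos
  have hlt : 2 ≤ n → Nat.totient n < n := fun h => Nat.totient_lt n (by omega)
  have hle := Nat.totient_le n
  have hbig : n ≤ np A := by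
    refine le_trans ?_ hnp
    calc n ≤ 1 * (n + (n - Nat.totient n)) := by omega
      _ ≤ _ := Nat.mul_le_mul_right _ hs0
  have h3 : 3 ≤ n → 4 * n - 4 ≤ np A := by
    intro h
    refine le_trans ?_ hnp
    obtain ⟨s, hs⟩ := Nat.totient_even (n := n) (by omega)
    have h1 := hlt (by omega)
    have h2 : 2 ≤ Nat.totient n := by omega
    generalize Nat.totient n = t at *
    zify [show t ≤ n from hle, show 4 ≤ 4 * n by omega]
    have : (2 : ℤ) ≤ t := by exact_mod_cast h2
    have : (t : ℤ) < n := by exact_mod_cast h1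
    nlinarith [mul_nonneg (show (0 : ℤ) ≤ t - 2 by linarith) (show (0 : ℤ) ≤ 2 * n - 2 - t by linarith)]
  refine ⟨fun h => ?_, fun h => ?_, fun h => ?_, hbig⟩
  · have := h3 (by omega); omega
  · have := h3 (by omega); omega
  · subst h; simpa using hnp

end ab
end GenPairs

namespace GenPairs
open scoped commutatorElement
set_option linter.unusedSectionVars false
section two
variable {G : Type*} [Group G]

theorem comm_le {x y : G} (hxy : Gen x y) (H : Subgroup G) [H.Normal]
    (h : x * y * x⁻¹ * y⁻¹ ∈ H) : commutator G ≤ H := by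
  have hg : Gen (x : G ⧸ H) (y : G ⧸ H) :=
    hxy.map (QuotientGroup.mk' H) (QuotientGroup.mk'_surjective H)
  have hc : (x : G ⧸ H) * y = y * x := by
    have := (QuotientGroup.eq_one_iff _).2 h
    simp only [QuotientGroup.mk_mul, QuotientGroup.mk_inv] at this
    rw [mul_inv_eq_one, mul_inv_eq_iff_eq_mul] at this
    exact this
  have hx := mem_center_of_gen hg rfl hc
  have hy := mem_center_of_gen hg hc.symm rfl
  have ht := gen_iff.1 hg _ hx hy
  rw [commutator_def, Subgroup.commutator_le]
  intro a _ b _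
  rw [← QuotientGroup.eq_one_iff, commutatorElement_def]
  simp only [QuotientGroup.mk_mul, QuotientGroup.mk_inv]
  have ha : (a : G ⧸ H) ∈ Subgroup.center (G ⧸ H) := by rw [ht]; trivial
  rw [← Subgroup.mem_center_iff.1 ha b]
  group

theorem pm_conj {x y c : G} (hxy : Gen x y) (h1 : x * c * x⁻¹ = c ∨ x * c * x⁻¹ = c⁻¹)
    (h2 : y * c * y⁻¹ = c ∨ y * c * y⁻¹ = c⁻¹) (g : G) :
    g * c * g⁻¹ = c ∨ g * c * g⁻¹ = c⁻¹ := by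
  let K : Subgroup G :=
    { carrier := {g | g * c * g⁻¹ = c ∨ g * c * g⁻¹ = c⁻¹}
      one_mem' := by left; group
      mul_mem' := by
        intro a b ha hb
        have e : a * b * c * (a * b)⁻¹ = a * (b * c * b⁻¹) * a⁻¹ := by group
        have e2 : a * c⁻¹ * a⁻¹ = (a * c * a⁻¹)⁻¹ := by group
        change a * b * c * (a * b)⁻¹ = c ∨ a * b * c * (a * b)⁻¹ = c⁻¹
        rw [e]
        rcases hb with hb | hb <;> rcases ha with ha | ha
        · left; rw [hb, ha]
        · right; rw [hb, ha]
        · right; rw [hb, e2, ha]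
        · left; rw [hb, e2, ha, inv_inv]
      inv_mem' := by
        intro a ha
        change a⁻¹ * c * a⁻¹⁻¹ = c ∨ a⁻¹ * c * a⁻¹⁻¹ = c⁻¹
        rcases ha with ha | ha
        · left
          calc _ = a⁻¹ * (a * c * a⁻¹) * a⁻¹⁻¹ := by rw [ha]
            _ = c := by group
        · right
          calc _ = (a⁻¹ * c⁻¹ * a)⁻¹ := by group
            _ = (a⁻¹ * (a * c * a⁻¹) * a)⁻¹ := by rw [ha]
            _ = c⁻¹ := by group }
  have : K = ⊤ := gen_iff.1 hxy K h1 h2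
  have hg : g ∈ K := by rw [this]; trivial
  exact hg

theorem zp_normal {c : G} (h : ∀ g : G, g * c * g⁻¹ = c ∨ g * c * g⁻¹ = c⁻¹) :
    (Subgroup.zpowers c).Normal := by
  constructor
  rintro _ ⟨i, rfl⟩ g
  have e : g * c ^ i * g⁻¹ = (g * c * g⁻¹) ^ i := by rw [conj_zpow]
  simp only
  rw [e]
  apply Subgroup.zpow_mem
  rcases h g with h | h <;> rw [h]
  · exact Subgroup.mem_zpowers c
  · exact Subgroup.inv_mem _ (Subgroup.mem_zpowers c)

theorem d3_iso {x y : G} (hxy : Gen x y) (N : Subgroup G) (hx : x ∉ N) (hy : y ∈ N)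
    (hx2 : x * x = 1) (hy3 : y * y * y = 1) (hy1 : y ≠ 1) (hc : x * y = y⁻¹ * x) :
    Nonempty (G ≃* DihedralGroup 3) := by
  have hp : ∀ i j : ZMod 3, y ^ (i + j).val = y ^ i.val * y ^ j.val := by
    intro i j
    rw [ZMod.val_add, ← pow_add]
    exact (pow_eq_pow_mod _ (by rw [pow_succ, pow_two]; exact hy3)).symm
  have hs : ∀ i j : ZMod 3, y ^ (j - i).val = (y ^ i.val)⁻¹ * y ^ j.val := by
    intro i j
    rw [eq_inv_mul_iff_mul_eq, ← hp]
    congr 2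
    ring
  have hcx : ∀ k : ℕ, y ^ k * x = x * (y ^ k)⁻¹ := by
    intro k
    have h1 : SemiconjBy x y y⁻¹ := hc
    have h2 := (h1.inv_right).pow_right k
    rw [inv_inv] at h2
    rw [← inv_pow]
    exact h2.eq.symm
  let f : DihedralGroup 3 → G := fun d => match d with
    | DihedralGroup.r i => y ^ i.val
    | DihedralGroup.sr i => x * y ^ i.val
  let F : DihedralGroup 3 →* G := MonoidHom.mk' f (by
    rintro (i | i) (j | j)
    · rw [DihedralGroup.r_mul_r]; exact hp i j
    · rw [DihedralGroup.r_mul_sr]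
      change x * y ^ (j - i).val = y ^ i.val * (x * y ^ j.val)
      rw [hs, ← mul_assoc, ← mul_assoc, hcx]
    · rw [DihedralGroup.sr_mul_r]
      change x * y ^ (i + j).val = x * y ^ i.val * y ^ j.val
      rw [hp, mul_assoc]
    · rw [DihedralGroup.sr_mul_sr]
      change y ^ (j - i).val = x * y ^ i.val * (x * y ^ j.val)
      rw [hs]
      calc _ = (x * x) * (y ^ i.val)⁻¹ * y ^ j.val := by rw [hx2]; group
        _ = x * (x * (y ^ i.val)⁻¹) * y ^ j.val := by group
        _ = x * (y ^ i.val * x) * y ^ j.val := by rw [hcx]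
        _ = _ := by group)
  refine ⟨(MulEquiv.ofBijective F ⟨?_, ?_⟩).symm⟩
  · rw [injective_iff_map_eq_one]
    rintro (i | i) h
    · have h : y ^ i.val = 1 := h
      have hi : i.val < 3 := i.val_lt
      have : i.val = 0 := by
        interval_cases hh : i.val
        · rfl
        · simp at h; exact absurd h hy1
        · exfalso
          rw [pow_two] at h
          rw [h, one_mul] at hy3
          exact hy1 hy3
      rw [ZMod.val_eq_zero] at this
      rw [this]; rfl
    · have h : x * y ^ i.val = 1 := h
      exfalso
      apply hx
      rw [mul_eq_one_iff_eq_inv] at h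
      rw [h]
      exact N.inv_mem (N.pow_mem hy _)
  · rw [← MonoidHom.range_eq_top]
    apply gen_iff.1 hxy
    · exact ⟨DihedralGroup.sr 0, by change x * y ^ 0 = x; simp⟩
    · exact ⟨DihedralGroup.r 1, by change y ^ 1 = y; simp⟩

theorem two_case [Finite G] (hZ : Subgroup.center G = ⊥) {u v : G} (huv : Gen u v)
    (N : Subgroup G) [N.Normal] (hN : N = commutator G) (hNt : N ≠ ⊤)
    (h2 : ∀ a b : G, a ∉ N → b ∉ N → a * b ∈ N)
    (hcj : ∀ a b c d : G, Gen a b → Gen c d → (a ∈ N ↔ c ∈ N) → (b ∈ N ↔ d ∈ N) →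
      Cj (a, b) (c, d)) : Nonempty (G ≃* DihedralGroup 3) := by
  obtain ⟨x, y, hxy, hx, hy⟩ : ∃ x y : G, Gen x y ∧ x ∉ N ∧ y ∈ N := by
    by_cases hu : u ∈ N
    · by_cases hv : v ∈ N
      · exact absurd (gen_iff.1 huv N hu hv) hNt
      · exact ⟨v, u, huv.symm, hv, hu⟩
    · by_cases hv : v ∈ N
      · exact ⟨u, v, huv, hu, hv⟩
      · refine ⟨u, u * v, huv.trans ?_, hu, h2 _ _ hu hv⟩
        intro H h1 h2
        exact ⟨h1, (H.mul_mem_cancel_left h1).1 h2⟩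
  have hnab : x * y ≠ y * x := by
    intro h
    apply hx
    rw [eq_one_of_gen hZ hxy rfl h]
    exact N.one_mem
  have hxyN : x * y ∉ N := fun h => hx ((N.mul_mem_cancel_right hy).1 h)
  have hg1 : Gen (x * y) y⁻¹ := by
    refine hxy.trans ?_
    intro H h1 h2
    have h3 := H.inv_mem h2
    rw [inv_inv] at h3
    exact ⟨(H.mul_mem_cancel_right h3).1 h1, h3⟩
  have hg2 : Gen (x * y) y := by
    refine hxy.trans ?_
    intro H h1 h2
    exact ⟨(H.mul_mem_cancel_right h2).1 h1, h2⟩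
  obtain ⟨h, e1, e2⟩ := hcj x y (x * y) y⁻¹ hxy hg1 (by simp [hx, hxyN]) (by simp)
  obtain ⟨k, k1, k2⟩ := hcj x y (x * y) y hxy hg2 (by simp [hx, hxyN]) (by simp)
  simp only at e1 e2 k1 k2
  have e3 : h * y⁻¹ * h⁻¹ = y := by
    calc _ = (h * y * h⁻¹)⁻¹ := by group
      _ = y := by rw [e2, inv_inv]
  have hh : h * h = 1 := by
    apply eq_one_of_gen hZ hxy
    · rw [← mul_inv_eq_iff_eq_mul]
      calc h * h * x * (h * h)⁻¹ = h * (h * x * h⁻¹) * h⁻¹ := by group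
        _ = h * (x * y) * h⁻¹ := by rw [e1]
        _ = (h * x * h⁻¹) * (h * y * h⁻¹) := by group
        _ = x := by rw [e1, e2]; group
    · rw [← mul_inv_eq_iff_eq_mul]
      calc h * h * y * (h * h)⁻¹ = h * (h * y * h⁻¹) * h⁻¹ := by group
        _ = y := by rw [e2, e3]
  have hgh : Gen x h := by
    refine hxy.trans ?_
    intro H h1 h2
    refine ⟨h1, (H.mul_mem_cancel_left h1).1 ?_⟩
    rw [← e1]
    exact H.mul_mem (H.mul_mem h2 h1) (H.inv_mem h2)
  have sqc : ∀ g a b : G, g * a * g⁻¹ = b → a * a = 1 → b * b = 1 := by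
    intro g a b e ha
    rw [← e]
    calc _ = g * (a * a) * g⁻¹ := by group
      _ = 1 := by rw [ha]; group
  by_cases hhN : h ∈ N
  · exfalso
    obtain ⟨g, g1, g2⟩ := hcj x h x y hgh hxy (by simp) (by simp [hhN, hy])
    simp only at g1 g2
    have hy2 : y * y = 1 := sqc _ _ _ g2 hh
    have hxx : x * x ∈ N := h2 _ _ hx hx
    have hg3 : Gen x (x * x * y) := by
      refine hxy.trans ?_
      intro H h1 h2
      exact ⟨h1, (H.mul_mem_cancel_left (H.mul_mem h1 h1)).1 h2⟩
    obtain ⟨l, l1, l2⟩ := hcj x y x (x * x * y) hxy hg3 (by simp)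
      (by simp [hy, N.mul_mem hxx hy])
    simp only at l1 l2
    have hq := sqc _ _ _ l2 hy2
    have hyi : y⁻¹ = y := inv_eq_of_mul_eq_one_left hy2
    have hinv : y * (x * x) * y⁻¹ = (x * x)⁻¹ := by
      rw [hyi, eq_comm, inv_eq_iff_mul_eq_one, ← hq]; group
    have hpm := pm_conj (c := x * x) hxy (by left; group) (Or.inr hinv)
    have := zp_normal hpm
    have hsq : (x * y) * (x * y) ∈ Subgroup.zpowers (x * x) := by
      have : (x * y) * (x * y) = k * (x * x) * k⁻¹ := by rw [← k1]; group
      rw [this]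
      rcases hpm k with h | h <;> rw [h]
      · exact Subgroup.mem_zpowers _
      · exact Subgroup.inv_mem _ (Subgroup.mem_zpowers _)
    have hle := comm_le hxy (Subgroup.zpowers (x * x)) (by
      have : x * y * x⁻¹ * y⁻¹ = (x * y) * (x * y) * (x * x) := by
        have h3 : y * (x * x) = (x * x)⁻¹ * y := mul_inv_eq_iff_eq_mul.1 hinv
        calc _ = x * y * x * ((x * x)⁻¹ * y) := by rw [hyi]; group
          _ = x * y * x * (y * (x * x)) := by rw [h3]
          _ = _ := by group
      rw [this]
      exact Subgroup.mul_mem _ hsq (Subgroup.mem_zpowers _))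
    obtain ⟨i, hi⟩ := hle (hN ▸ hy)
    apply hnab
    have hi : (x * x) ^ i = y := hi
    rw [← hi]
    have : Commute x (x * x) := by unfold Commute SemiconjBy; group
    exact this.zpow_right i
  · have hhx : h * x ∈ N := h2 _ _ hhN hx
    have hg3 : Gen h (h * x) := by
      refine hgh.trans ?_
      intro H h1 h2
      exact ⟨(H.mul_mem_cancel_left h1).1 h2, h1⟩
    obtain ⟨g, g1, g2⟩ := hcj h (h * x) x y hg3 hxy (by simp [hhN, hx]) (by simp [hhx, hy])
    simp only at g1 g2
    have hx2 : x * x = 1 := sqc _ _ _ g1 hh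
    have hxy2 := sqc _ _ _ k1 hx2
    have hxi : x⁻¹ = x := inv_eq_of_mul_eq_one_left hx2
    have hinv : x * y * x⁻¹ = y⁻¹ := by
      rw [hxi, eq_comm, inv_eq_iff_mul_eq_one]
      have : y * (x * y * x) = x⁻¹ * ((x * y) * (x * y)) * x := by group
      rw [this, hxy2]; group
    have hpm := pm_conj (c := y) hxy (Or.inr hinv) (by left; group)
    have hpm2 : ∀ g : G, g * (y * y) * g⁻¹ = y * y ∨ g * (y * y) * g⁻¹ = (y * y)⁻¹ := by
      intro g
      have e : g * (y * y) * g⁻¹ = (g * y * g⁻¹) * (g * y * g⁻¹) := by group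
      rcases hpm g with h | h
      · left; rw [e, h]
      · right; rw [e, h]; group
    have := zp_normal hpm2
    have hle := comm_le hxy (Subgroup.zpowers (y * y)) (by
      have : x * y * x⁻¹ * y⁻¹ = (y * y)⁻¹ := by rw [hinv]; group
      rw [this]
      exact Subgroup.inv_mem _ (Subgroup.mem_zpowers _))
    have hyy := hle (hN ▸ hy)
    have hg4 : Gen x (y * y) := by
      refine hxy.trans ?_
      intro H h1 h2
      exact ⟨h1, (Subgroup.zpowers_le.2 h2) hyy⟩
    obtain ⟨l, l1, l2⟩ := hcj x y x (y * y) hxy hg4 (by simp) (by simp [hy, N.mul_mem hy hy])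
    simp only at l1 l2
    have hy1 : y ≠ 1 := by
      rintro rfl
      exact hnab (by simp)
    refine d3_iso hxy N hx hy hx2 ?_ hy1 ?_
    · rcases hpm l with h | h
      · rw [h] at l2
        exact absurd (mul_eq_left.1 l2.symm) hy1
      · rw [h] at l2
        rw [← l2]; group
    · rw [← hinv]; group

end two
end GenPairs

namespace GenPairs
open scoped commutatorElement
set_option linter.unusedSectionVars false

theorem ab_noncyclic' {A : Type*} [Group A] [Finite A] (hcomm : ∀ a b : A, a * b = b * a)
    {x y : A} (hxy : Gen x y) (hnc : ¬ IsCyclic A)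
    (hepi : ¬ ∃ f : A →* Multiplicative (ZMod 2 × ZMod 2), Function.Surjective f) :
    4 * Nat.card A ≤ np A ∧ (6 * Nat.card A ≤ np A ∨
      Nonempty (A ≃* Multiplicative (ZMod 3 × ZMod 3))) := by
  let i : CommGroup A := { ‹Group A› with mul_comm := hcomm }
  exact ab_noncyclic (A := A) hxy hnc hepi

theorem ab_cyclic' {A : Type*} [Group A] [Finite A] (hcomm : ∀ a b : A, a * b = b * a)
    (hc : IsCyclic A) :
    (4 ≤ Nat.card A → 3 * Nat.card A ≤ np A) ∧ (Nat.card A = 3 → 8 ≤ np A) ∧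
      (Nat.card A = 2 → 3 ≤ np A) ∧ Nat.card A ≤ np A := by
  let i : CommGroup A := { ‹Group A› with mul_comm := hcomm }
  exact ab_cyclic (A := A) hc

section main
variable {G : Type*} [Group G]

theorem comm_le_of_center (H : Subgroup G)
    (hdec : ∀ g : G, ∃ k ∈ H, ∃ f ∈ Subgroup.center G, g = k * f) : commutator G ≤ H := by
  rw [commutator_def, Subgroup.commutator_le]
  intro a _ b _
  obtain ⟨k, hk, f, hf, rfl⟩ := hdec a
  obtain ⟨l, hl, f', hf', rfl⟩ := hdec b
  rw [Subgroup.mem_center_iff] at hf hf'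
  have : ⁅k * f, l * f'⁆ = ⁅k, l⁆ := by
    simp only [commutatorElement_def]
    have c1 : k * f * (l * f') = k * l * (f * f') := by
      rw [show k * f * (l * f') = k * (f * l) * f' by group, ← hf l]; group
    have c2 : (l * f') * (k * f) = l * k * (f * f') := by
      rw [show l * f' * (k * f) = l * (f' * k) * f by group, ← hf' k, ← hf f']
      rw [show l * (k * f') * f = l * k * (f' * f) by group, hf f']
    calc _ = (k * f * (l * f')) * ((l * f') * (k * f))⁻¹ := by group
      _ = _ := by rw [c1, c2]; group
  rw [this]
  exact H.mul_mem (H.mul_mem (H.mul_mem hk hl) (H.inv_mem hk)) (H.inv_mem hl)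

theorem mk_comm (a b : G ⧸ commutator G) : a * b = b * a := by
  obtain ⟨a, rfl⟩ := QuotientGroup.mk_surjective a
  obtain ⟨b, rfl⟩ := QuotientGroup.mk_surjective b
  rw [← QuotientGroup.mk_mul, ← QuotientGroup.mk_mul, QuotientGroup.eq]
  have : (a * b)⁻¹ * (b * a) = ⁅b⁻¹, a⁻¹⁆ := by rw [commutatorElement_def]; group
  rw [this]
  exact Subgroup.commutator_mem_commutator (Subgroup.mem_top _) (Subgroup.mem_top _)

theorem mk_conj (a b : G) : ((a * b * a⁻¹ : G) : G ⧸ commutator G) = b := by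
  rw [QuotientGroup.mk_mul, mk_comm, ← QuotientGroup.mk_mul]
  congr 1; group

variable [Finite G]

theorem prod_case {x y : G} (hxy : Gen x y)
    (hF : Subgroup.center G ⊓ commutator G = ⊥) (hS : Subgroup.center G ⊔ commutator G = ⊤)
    (hnab : commutator G ≠ ⊥)
    (hA : Nat.card (G ⧸ commutator G) ≤ np (G ⧸ commutator G)) :
    6 * Nat.card G ≤ np G := by
  have hdec : ∀ g : G, ∃ z ∈ Subgroup.center G, ∃ n ∈ commutator G, z * n = g := by
    intro g
    apply Subgroup.mem_sup_of_normal_left.1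
    rw [hS]; trivial
  have hF' : ∀ g : G, g ∈ Subgroup.center G → g ∈ commutator G → g = 1 := by
    intro g h1 h2
    have : g ∈ Subgroup.center G ⊓ commutator G := ⟨h1, h2⟩
    rwa [hF, Subgroup.mem_bot] at this
  have hP1 : Nontrivial (G ⧸ Subgroup.center G) := by
    rw [QuotientGroup.nontrivial_iff]
    intro h
    exact hnab ((commutator_eq_bot_iff_center_eq_top G).2 h)
  have hP2 : commutator (G ⧸ Subgroup.center G) = ⊤ := by
    rw [eq_top_iff]
    rintro q -
    obtain ⟨g, rfl⟩ := QuotientGroup.mk_surjective q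
    obtain ⟨z, hz, n, hn, rfl⟩ := hdec g
    rw [QuotientGroup.mk_mul, (QuotientGroup.eq_one_iff z).2 hz, one_mul]
    have h1 : (QuotientGroup.mk' (Subgroup.center G)) n ∈
        (commutator G).map (QuotientGroup.mk' (Subgroup.center G)) := ⟨n, hn, rfl⟩
    rw [commutator_def, Subgroup.map_commutator] at h1
    exact Subgroup.commutator_mono le_top le_top h1
  have hP3 : Subgroup.center (G ⧸ Subgroup.center G) = ⊥ := by
    rw [eq_bot_iff]
    intro q hq
    obtain ⟨g, rfl⟩ := QuotientGroup.mk_surjective q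
    rw [Subgroup.mem_bot, QuotientGroup.eq_one_iff, Subgroup.mem_center_iff]
    intro h
    have h1 := Subgroup.mem_center_iff.1 hq h
    rw [← QuotientGroup.mk_mul, ← QuotientGroup.mk_mul, QuotientGroup.eq] at h1
    have h2 : (h * g)⁻¹ * (g * h) ∈ commutator G := by
      rw [← QuotientGroup.eq, QuotientGroup.mk_mul, mk_comm, QuotientGroup.mk_mul]
    exact (inv_mul_eq_one.1 (hF' _ h1 h2))
  have h6 := perfect_six hP2 hP3 (hxy.map (QuotientGroup.mk' _) (QuotientGroup.mk'_surjective _))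
  have hc : ∀ (a : G ⧸ Subgroup.center G) (b : G ⧸ commutator G), ∃ g : G,
      (g : G ⧸ Subgroup.center G) = a ∧ (g : G ⧸ commutator G) = b := by
    intro a b
    obtain ⟨a, rfl⟩ := QuotientGroup.mk_surjective a
    obtain ⟨b, rfl⟩ := QuotientGroup.mk_surjective b
    obtain ⟨z, hz, n, hn, e⟩ := hdec (a⁻¹ * b)
    refine ⟨a * z, QuotientGroup.mk_mul_of_mem _ hz, ?_⟩
    have : a * z = b * n⁻¹ := by
      rw [eq_mul_inv_iff_mul_eq, mul_assoc, e]; group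
    rw [this, QuotientGroup.mk_mul_of_mem _ ((commutator G).inv_mem hn)]
  choose c hc1 hc2 using hc
  have hle : np (G ⧸ Subgroup.center G) * np (G ⧸ commutator G) ≤ np G := by
    unfold np
    rw [← Nat.card_prod]
    let Φ : {p : (G ⧸ Subgroup.center G) × (G ⧸ Subgroup.center G) | Gen p.1 p.2} ×
        {p : (G ⧸ commutator G) × (G ⧸ commutator G) | Gen p.1 p.2} →
        {p : G × G | Gen p.1 p.2} := fun q =>
      ⟨(c q.1.1.1 q.2.1.1, c q.1.1.2 q.2.1.2), by
        obtain ⟨⟨p, hp⟩, ⟨q, hq⟩⟩ := q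
        change Gen (c p.1 q.1) (c p.2 q.2)
        rw [gen_iff]
        intro H hx hy
        have t1 := gen_iff.1 hp (H.map (QuotientGroup.mk' _)) ⟨_, hx, hc1 _ _⟩ ⟨_, hy, hc1 _ _⟩
        have t2 := gen_iff.1 hq (H.map (QuotientGroup.mk' _)) ⟨_, hx, hc2 _ _⟩ ⟨_, hy, hc2 _ _⟩
        have hN : commutator G ≤ H := by
          apply comm_le_of_center
          intro g
          have : (g : G ⧸ Subgroup.center G) ∈ H.map (QuotientGroup.mk' _) := by rw [t1]; trivial
          obtain ⟨k, hk, e⟩ := this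
          exact ⟨k, hk, k⁻¹ * g, QuotientGroup.eq.1 e, by group⟩
        rw [eq_top_iff]
        intro g _
        have : (g : G ⧸ commutator G) ∈ H.map (QuotientGroup.mk' _) := by rw [t2]; trivial
        obtain ⟨k, hk, e⟩ := this
        exact (H.mul_mem_cancel_left (H.inv_mem hk)).1 (hN (QuotientGroup.eq.1 e))⟩
    apply Nat.card_le_card_of_injective Φ
    rintro ⟨⟨⟨p1, p2⟩, hp⟩, ⟨⟨q1, q2⟩, hq⟩⟩ ⟨⟨⟨p1', p2'⟩, hp'⟩, ⟨⟨q1', q2'⟩, hq'⟩⟩ h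
    have h := congrArg Subtype.val h
    have i1 : c p1 q1 = c p1' q1' := congrArg Prod.fst h
    have i2 : c p2 q2 = c p2' q2' := congrArg Prod.snd h
    have j1 : p1 = p1' := by rw [← hc1 p1 q1, i1, hc1]
    have j2 : p2 = p2' := by rw [← hc1 p2 q2, i2, hc1]
    have j3 : q1 = q1' := by rw [← hc2 p1 q1, i1, hc2]
    have j4 : q2 = q2' := by rw [← hc2 p2 q2, i2, hc2]
    subst j1 j2 j3 j4
    rfl
  have hcard : Nat.card G ≤ Nat.card (G ⧸ Subgroup.center G) * Nat.card (G ⧸ commutator G) := by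
    rw [← Nat.card_prod]
    apply Nat.card_le_card_of_injective
      (fun g : G => ((g : G ⧸ Subgroup.center G), (g : G ⧸ commutator G)))
    intro a b h
    have h1 := congrArg Prod.fst h
    have h2 := congrArg Prod.snd h
    exact inv_mul_eq_one.1 (hF' _ (QuotientGroup.eq.1 h1) (QuotientGroup.eq.1 h2))
  calc 6 * Nat.card G ≤ 6 * (Nat.card (G ⧸ Subgroup.center G) * Nat.card (G ⧸ commutator G)) :=
        Nat.mul_le_mul_left _ hcard
    _ = 6 * Nat.card (G ⧸ Subgroup.center G) * Nat.card (G ⧸ commutator G) := by ring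
    _ ≤ _ := (Nat.mul_le_mul h6 hA).trans hle

theorem two_final {x y : G} (hxy : Gen x y) (hZ : Subgroup.center G = ⊥)
    (hi : Nat.card (G ⧸ commutator G) = 2) (h3 : 3 ≤ np (G ⧸ commutator G)) :
    6 * Nat.card G ≤ np G ∨ Nonempty (G ≃* DihedralGroup 3) := by
  by_cases hcj : ∀ a b c d : G, Gen a b → Gen c d → (a ∈ commutator G ↔ c ∈ commutator G) →
      (b ∈ commutator G ↔ d ∈ commutator G) → Cj (a, b) (c, d)
  · right
    have hi' : (commutator G).index = 2 := by rw [Subgroup.index_eq_card, hi]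
    refine two_case hZ hxy (commutator G) rfl ?_ ?_ hcj
    · intro h
      rw [h, Subgroup.index_top] at hi'
      omega
    · intro a b ha hb
      rw [Subgroup.mul_mem_iff_of_index_two hi']
      tauto
  · left
    push Not at hcj
    obtain ⟨a, b, c, d, hab, hcd, hac, hbd, hn⟩ := hcj
    have hi' : (commutator G).index = 2 := by rw [Subgroup.index_eq_card, hi]
    have hm : ∀ a c : G, (a ∈ commutator G ↔ c ∈ commutator G) →
        (c : G ⧸ commutator G) = a := by
      intro a c h
      rw [QuotientGroup.eq, Subgroup.mul_mem_iff_of_index_two hi', inv_mem_iff]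
      exact h.symm
    have hg := hab.map (QuotientGroup.mk' (commutator G)) (QuotientGroup.mk'_surjective _)
    have hcount := conj_count (ι := Bool)
      (LL (commutator G) ⊤ (QuotientGroup.mk' (commutator G) a) (QuotientGroup.mk' (commutator G) b))
      (fun i => if i then (a, b) else (c, d))
      (by
        rintro (_ | _) g
        · refine ⟨hcd.conj g, ?_, ?_⟩
          · change ((g * c * g⁻¹ : G) : G ⧸ commutator G) = a
            rw [mk_conj, hm _ _ hac]
          · change ((g * d * g⁻¹ : G) : G ⧸ commutator G) = b
            rw [mk_conj, hm _ _ hbd]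
        · exact ⟨hab.conj g, mk_conj _ _, mk_conj _ _⟩)
      (by
        rintro (_ | _)
        · exact hcd
        · exact hab)
      (by
        rintro (_ | _) (_ | _) h
        · rfl
        · exact absurd (Cj.symm h) hn
        · exact absurd h hn
        · rfl)
    have e : Nat.card (G ⧸ Subgroup.center G) = Nat.card G := by
      rw [hZ]
      exact Nat.card_congr QuotientGroup.quotientBot.toEquiv
    rw [e, show Nat.card Bool = 2 by simp] at hcount
    rw [np_eq (commutator G) hg]
    calc 6 * Nat.card G = 3 * (2 * Nat.card G) := by ring
      _ ≤ _ := Nat.mul_le_mul h3 hcount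

end main

universe u
theorem main_aux (n : ℕ) : ∀ (G : Type u) [Group G] [Finite G], Nat.card G = n → ¬ IsCyclic G →
    (∃ a b : G, Gen a b) →
    (¬ ∃ f : G →* Multiplicative (ZMod 2 × ZMod 2), Function.Surjective f) →
    3 * Nat.card G ≤ np G ∧ (6 * Nat.card G ≤ np G ∨ Nonempty (G ≃* DihedralGroup 3) ∨
      Nonempty (G ≃* Multiplicative (ZMod 3 × ZMod 3))) := by
  induction n using Nat.strong_induction_on with
  | _ n ih =>
  intro G _ _ hn hnc hgen hepi
  have hepiq : ∀ (N : Subgroup G) [N.Normal], ¬ ∃ f : (G ⧸ N) →* Multiplicative (ZMod 2 × ZMod 2),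
      Function.Surjective f := by
    rintro N _ ⟨f, hf⟩
    exact hepi ⟨f.comp (QuotientGroup.mk' N), hf.comp (QuotientGroup.mk'_surjective N)⟩
  have hGpos : 0 < Nat.card G := Nat.card_pos
  have six3 : 6 * Nat.card G ≤ np G → 3 * Nat.card G ≤ np G ∧ (6 * Nat.card G ≤ np G ∨
      Nonempty (G ≃* DihedralGroup 3) ∨ Nonempty (G ≃* Multiplicative (ZMod 3 × ZMod 3))) :=
    fun h => ⟨by omega, Or.inl h⟩
  obtain ⟨x, y, hxy⟩ := hgen
  by_cases hnab : commutator G = ⊥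
  · have hct := (commutator_eq_bot_iff_center_eq_top G).1 hnab
    have hcomm : ∀ a b : G, a * b = b * a := by
      intro a b
      have : b ∈ Subgroup.center G := by rw [hct]; trivial
      exact Subgroup.mem_center_iff.1 this a
    obtain ⟨h1, h2⟩ := ab_noncyclic' hcomm hxy hnc hepi
    refine ⟨by omega, ?_⟩
    rcases h2 with h2 | h2
    · exact Or.inl h2
    · exact Or.inr (Or.inr h2)
  by_cases hF : Subgroup.center G ⊓ commutator G = ⊥
  · have hxyA : Gen (QuotientGroup.mk' (commutator G) x) (QuotientGroup.mk' (commutator G) y) :=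
      hxy.map (QuotientGroup.mk' (commutator G)) (QuotientGroup.mk'_surjective _)
    by_cases hS : Subgroup.center G ⊔ commutator G = ⊤
    · apply six3
      apply prod_case hxy hF hS hnab
      by_cases hc : IsCyclic (G ⧸ commutator G)
      · exact (ab_cyclic' mk_comm hc).2.2.2
      · have := (ab_noncyclic' mk_comm hxyA hc (hepiq _)).1
        omega
    · have hge := np_ge_ab hxy
      have hidx : Nat.card (commutator G) * (Subgroup.center G ⊔ commutator G).index =
          Nat.card (G ⧸ Subgroup.center G) := by
        rw [← Subgroup.index_eq_card, ← Subgroup.relIndex_mul_index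
          (le_sup_left : Subgroup.center G ≤ Subgroup.center G ⊔ commutator G),
          Subgroup.relIndex_sup_left, ← Subgroup.inf_relIndex_right, hF,
          Subgroup.relIndex_bot_left]
      have hdvd : (Subgroup.center G ⊔ commutator G).index ∣ Nat.card (G ⧸ commutator G) := by
        rw [← Subgroup.index_eq_card]
        exact Subgroup.index_dvd_of_le le_sup_right
      have he1 : (Subgroup.center G ⊔ commutator G).index ≠ 1 := by
        rwa [Ne, Subgroup.index_eq_one]
      have he0 : (Subgroup.center G ⊔ commutator G).index ≠ 0 := Subgroup.index_ne_zero_of_finite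
      have hcG : Nat.card (commutator G) * Nat.card (G ⧸ commutator G) = Nat.card G := by
        rw [← Subgroup.index_eq_card, Subgroup.card_mul_index]
      have hZidx : Nat.card (Subgroup.center G) * Nat.card (G ⧸ Subgroup.center G) = Nat.card G := by
        rw [← Subgroup.index_eq_card, Subgroup.card_mul_index]
      have hmk := @mk_comm G _
      have htwo := two_final hxy
      have hcyc := fun hc : IsCyclic (G ⧸ commutator G) => ab_cyclic' mk_comm hc
      have hncyc := fun hc : ¬ IsCyclic (G ⧸ commutator G) =>
        (ab_noncyclic' mk_comm hxyA hc (hepiq _)).1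
      have hNpos : 0 < Nat.card (commutator G) := Nat.card_pos
      have hApos : 0 < Nat.card (G ⧸ commutator G) := Nat.card_pos
      generalize (Subgroup.center G ⊔ commutator G).index = e at *
      rw [← hidx] at hge
      have big : 3 * Nat.card (G ⧸ commutator G) ≤ np (G ⧸ commutator G) →
          6 * Nat.card G ≤ np G := by
        intro h
        refine le_trans ?_ hge
        rw [← hcG]
        calc _ = (3 * Nat.card (G ⧸ commutator G)) * (Nat.card (commutator G) * 2) := by ring
          _ ≤ _ := Nat.mul_le_mul h (Nat.mul_le_mul_left _ (by omega))
      by_cases hc : IsCyclic (G ⧸ commutator G)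
      · obtain ⟨c4, c3, c2, -⟩ := hcyc hc
        by_cases h4 : 4 ≤ Nat.card (G ⧸ commutator G)
        · exact six3 (big (c4 h4))
        · have : Nat.card (G ⧸ commutator G) = 1 ∨ Nat.card (G ⧸ commutator G) = 2 ∨
            Nat.card (G ⧸ commutator G) = 3 := by omega
          rcases this with h | h | h
          · rw [h, Nat.dvd_one] at hdvd
            exact absurd hdvd he1
          · have he : e = 2 := by
              rw [h] at hdvd
              have := Nat.le_of_dvd (by norm_num) hdvd
              omega
            subst he
            rw [h] at hcG
            rw [hcG] at hge hidx
            rw [← hidx] at hZidx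
            have hZ : Subgroup.center G = ⊥ := by
              rw [← Subgroup.card_eq_one]
              exact Nat.eq_of_mul_eq_mul_right hGpos (by rw [one_mul]; exact hZidx)
            refine ⟨(Nat.mul_le_mul_right _ (c2 h)).trans hge, ?_⟩
            rcases htwo hZ h (c2 h) with h | h
            · exact Or.inl h
            · exact Or.inr (Or.inl h)
          · have he : e = 3 := by
              rw [h] at hdvd
              have := Nat.le_of_dvd (by norm_num) hdvd
              have : e ≠ 2 := by rintro rfl; omega
              omega
            subst he
            rw [h] at hcG
            rw [hcG] at hge
            apply six3
            have := Nat.mul_le_mul_right (Nat.card G) (c3 h)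
            omega
      · have := hncyc hc
        exact six3 (big (by omega))
  · apply six3
    have hge := np_ge_frat (Subgroup.center G ⊓ commutator G) inf_le_left inf_le_right
    have hcF : Nat.card (Subgroup.center G ⊓ commutator G : Subgroup G) *
        Nat.card (G ⧸ (Subgroup.center G ⊓ commutator G)) = Nat.card G := by
      rw [← Subgroup.index_eq_card, Subgroup.card_mul_index]
    have hF2 : 2 ≤ Nat.card (Subgroup.center G ⊓ commutator G : Subgroup G) := by
      have h0 : 0 < Nat.card (Subgroup.center G ⊓ commutator G : Subgroup G) := Nat.card_pos
      have h1 : Nat.card (Subgroup.center G ⊓ commutator G : Subgroup G) ≠ 1 := by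
        rwa [Ne, Subgroup.card_eq_one]
      omega
    have hQpos : 0 < Nat.card (G ⧸ (Subgroup.center G ⊓ commutator G)) := Nat.card_pos
    have hlt : Nat.card (G ⧸ (Subgroup.center G ⊓ commutator G)) < n := by
      rw [← hn, ← hcF]
      nlinarith
    have hqc : ¬ IsCyclic (G ⧸ (Subgroup.center G ⊓ commutator G)) := by
      intro hc
      apply hnab
      rw [commutator_eq_bot_iff]
      apply (QuotientGroup.mk' (Subgroup.center G ⊓
        commutator G)).isMulCommutative_of_isCyclic_of_ker_le_center
      rw [QuotientGroup.ker_mk']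
      exact inf_le_left
    have h3 := (ih _ hlt (G ⧸ (Subgroup.center G ⊓ commutator G)) rfl hqc
      ⟨_, _, hxy.map (QuotientGroup.mk' _) (QuotientGroup.mk'_surjective _)⟩ (hepiq _)).1
    refine le_trans ?_ hge
    rw [← hcF]
    generalize Nat.card (Subgroup.center G ⊓ commutator G : Subgroup G) = f at *
    calc _ = (3 * Nat.card (G ⧸ (Subgroup.center G ⊓ commutator G))) * (2 * f) := by ring
      _ ≤ _ := Nat.mul_le_mul h3 (Nat.mul_le_mul_right _ hF2)

end GenPairs

/-- Let `G` be a finite non-cyclic 2-generated group such that `C2 × C2`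
is not an epimorphic image of `G`. If the number of ordered pairs `(x, y) ∈ G × G` with
`⟨x, y⟩ = G` is strictly less than `6·|G|`, then `G` is isomorphic to one of:
`D3`, `C3 × C3`, or `A4`. -/
theorem stmt_11 {G : Type*} [Group G] [Finite G] (hnc : ¬ IsCyclic G)
    (h2gen : ∃ a b : G, Subgroup.closure {a, b} = ⊤)
    (hepi : ¬ ∃ f : G →* Multiplicative (ZMod 2 × ZMod 2), Function.Surjective f)
    (h : Nat.card {p : G × G | Subgroup.closure {p.1, p.2} = ⊤} < 6 * Nat.card G) :
    Nonempty (G ≃* DihedralGroup 3) ∨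
    Nonempty (G ≃* Multiplicative (ZMod 3 × ZMod 3)) ∨
    Nonempty (G ≃* alternatingGroup (Fin 4)) := by
  rcases (GenPairs.main_aux _ G rfl hnc h2gen hepi).2 with h6 | hD | hC
  · exact absurd h6 (not_le.2 h)
  · exact Or.inl hD
  · exact Or.inr (Or.inl hC)
end

section
/- Let G be a finite group, let N be a normal subgroup of G, and let g1, g2 be elements of G with ⟨g1, g2⟩N = G. Then the number of ordered pairs (x, y) ∈ G × G with ⟨x, y⟩ = G equals the number of ordered pairs (u, v) ∈ (G/N) × (G/N) with ⟨u, v⟩ = G/N multiplied by the cardinality of Φ_N(g1,g2). -/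
open Classical in
/-- The pairs over `(u,v)` that generate exactly `H`. -/
noncomputable def genOver {G : Type*} [Group G] [Fintype G] (N : Subgroup G) [N.Normal]
    (H : Subgroup G) (w : (G ⧸ N) × (G ⧸ N)) : Finset (G × G) :=
  Finset.univ.filter fun p => Subgroup.closure {p.1, p.2} = H ∧
    ((p.1 : G ⧸ N), (p.2 : G ⧸ N)) = w

open Classical in
/-- The pairs in `H` over `(u,v)`. -/
noncomputable def allOver {G : Type*} [Group G] [Fintype G] (N : Subgroup G) [N.Normal]
    (H : Subgroup G) (w : (G ⧸ N) × (G ⧸ N)) : Finset (G × G) :=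
  Finset.univ.filter fun p => (p.1 ∈ H ∧ p.2 ∈ H) ∧
    ((p.1 : G ⧸ N), (p.2 : G ⧸ N)) = w

theorem map_closure_pair' {G : Type*} [Group G] (N : Subgroup G) [N.Normal] (x y : G) :
    (Subgroup.closure {x, y}).map (QuotientGroup.mk' N) =
      Subgroup.closure {(x : G ⧸ N), (y : G ⧸ N)} := by
  rw [MonoidHom.map_closure, Set.image_pair]; rfl

theorem allOver_card_le {G : Type*} [Group G] [Fintype G] (N : Subgroup G) [N.Normal]
    (H : Subgroup G) (hH : H.map (QuotientGroup.mk' N) = ⊤) (w w' : (G ⧸ N) × (G ⧸ N)) :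
    (allOver N H w).card ≤ (allOver N H w').card := by
  have hs : ∀ z : G ⧸ N, ∃ h ∈ H, (h : G ⧸ N) = z := by
    intro z
    have : z ∈ H.map (QuotientGroup.mk' N) := by rw [hH]; trivial
    exact this
  obtain ⟨a, ha, ha'⟩ := hs (w.1⁻¹ * w'.1)
  obtain ⟨b, hb, hb'⟩ := hs (w.2⁻¹ * w'.2)
  refine Finset.card_le_card_of_injOn (fun p => (p.1 * a, p.2 * b)) ?_ ?_
  · intro p hp
    simp only [allOver, Finset.coe_filter, Finset.mem_univ, true_and, Set.mem_setOf_eq] at hp ⊢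
    obtain ⟨⟨h1, h2⟩, rfl⟩ := hp
    refine ⟨⟨H.mul_mem h1 ha, H.mul_mem h2 hb⟩, ?_⟩
    ext
    · simp [ha']
    · simp [hb']
  · intro p _ q _ h
    simp only [Prod.mk.injEq, mul_left_inj] at h
    exact Prod.ext h.1 h.2

open Classical in
theorem allOver_card_sum {G : Type*} [Group G] [Fintype G] (N : Subgroup G) [N.Normal]
    (H : Subgroup G) (w : (G ⧸ N) × (G ⧸ N)) :
    (allOver N H w).card = (genOver N H w).card +
      ∑ K ∈ (Finset.univ : Finset (Subgroup G)).filter (· < H), (genOver N K w).card := by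
  have h1 : (allOver N H w).card =
      ∑ K ∈ (Finset.univ : Finset (Subgroup G)).filter (· ≤ H), (genOver N K w).card := by
    rw [Finset.card_eq_sum_card_fiberwise (f := fun p => Subgroup.closure {p.1, p.2})
      (t := (Finset.univ : Finset (Subgroup G)).filter (· ≤ H))]
    · refine Finset.sum_congr rfl fun K hK => ?_
      congr 1
      ext p
      simp only [allOver, genOver, Finset.mem_filter, Finset.mem_univ, true_and] at hK ⊢
      constructor
      · rintro ⟨⟨_, h⟩, h'⟩
        exact ⟨h', h⟩
      · rintro ⟨rfl, h⟩
        rw [Subgroup.closure_le, Set.pair_subset_iff] at hK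
        exact ⟨⟨hK, h⟩, rfl⟩
    · intro p hp
      simp only [allOver, Finset.coe_filter, Finset.mem_univ, true_and, Set.mem_setOf_eq] at hp ⊢
      rw [Subgroup.closure_le, Set.pair_subset_iff]
      exact hp.1
  have h2 : (Finset.univ : Finset (Subgroup G)).filter (· ≤ H) =
      insert H ((Finset.univ : Finset (Subgroup G)).filter (· < H)) := by
    ext K
    simp [le_iff_eq_or_lt]
  rw [h1, h2, Finset.sum_insert (by simp)]

theorem genOver_card_eq {G : Type*} [Group G] [Fintype G] (N : Subgroup G) [N.Normal]
    (w w' : (G ⧸ N) × (G ⧸ N)) (hw : Subgroup.closure {w.1, w.2} = ⊤)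
    (hw' : Subgroup.closure {w'.1, w'.2} = ⊤) (H : Subgroup G) :
    (genOver N H w).card = (genOver N H w').card := by
  classical
  induction H using WellFoundedLT.induction with
  | ind H ih =>
  by_cases hH : H.map (QuotientGroup.mk' N) = ⊤
  · have e := le_antisymm (allOver_card_le N H hH w w') (allOver_card_le N H hH w' w)
    rw [allOver_card_sum, allOver_card_sum, Finset.sum_congr rfl
      (fun K hK => ih K (Finset.mem_filter.1 hK).2)] at e
    exact Nat.add_right_cancel e
  · have key : ∀ z : (G ⧸ N) × (G ⧸ N), Subgroup.closure {z.1, z.2} = ⊤ →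
        genOver N H z = ∅ := by
      intro z hz
      refine Finset.filter_eq_empty_iff.2 ?_
      rintro p _ ⟨rfl, rfl⟩
      exact hH (by rw [map_closure_pair']; exact hz)
    rw [key w hw, key w' hw']

/-- Let `G` be a finite group, `N` a normal subgroup of `G`, and
`g1, g2 ∈ G` with `⟨g1, g2⟩N = G`. Then the number of ordered pairs `(x, y) ∈ G × G`
with `⟨x, y⟩ = G` equals the number of ordered pairs `(u, v) ∈ (G/N) × (G/N)` generating
`G/N` multiplied by `|Φ_N(g1,g2)|`. -/
theorem stmt_13 {G : Type*} [Group G] [Finite G] (N : Subgroup G) [N.Normal]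
    (g1 g2 : G) (hgen : Subgroup.closure {g1, g2} ⊔ N = ⊤) :
    Nat.card {p : G × G | Subgroup.closure {p.1, p.2} = ⊤} =
      Nat.card {u : (G ⧸ N) × (G ⧸ N) | Subgroup.closure {u.1, u.2} = ⊤} *
        Nat.card {q : G × G | q.1 ∈ N ∧ q.2 ∈ N ∧
          Subgroup.closure {g1 * q.1, g2 * q.2} = ⊤} := by
  classical
  have := Fintype.ofFinite G
  have hg : Subgroup.closure {(g1 : G ⧸ N), (g2 : G ⧸ N)} = ⊤ := by
    have h := congrArg (Subgroup.map (QuotientGroup.mk' N)) hgen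
    rw [Subgroup.map_sup, map_closure_pair', QuotientGroup.map_mk'_self, sup_bot_eq,
      Subgroup.map_top_of_surjective _ (QuotientGroup.mk'_surjective N)] at h
    exact h
  have hPhi : Nat.card {q : G × G | q.1 ∈ N ∧ q.2 ∈ N ∧
          Subgroup.closure {g1 * q.1, g2 * q.2} = ⊤} =
      (genOver N ⊤ ((g1 : G ⧸ N), (g2 : G ⧸ N))).card := by
    rw [Set.coe_setOf, Nat.card_eq_fintype_card, Fintype.card_subtype]
    refine Finset.card_bij' (fun q _ => (g1 * q.1, g2 * q.2))
      (fun p _ => (g1⁻¹ * p.1, g2⁻¹ * p.2)) ?_ ?_ ?_ ?_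
    · intro q hq
      simp only [genOver, Finset.mem_filter, Finset.mem_univ, true_and] at hq ⊢
      refine ⟨hq.2.2, ?_⟩
      ext
      · simpa using hq.1
      · simpa using hq.2.1
    · intro p hp
      simp only [genOver, Finset.mem_filter, Finset.mem_univ, true_and, Prod.mk.injEq] at hp ⊢
      refine ⟨QuotientGroup.eq.1 hp.2.1.symm, QuotientGroup.eq.1 hp.2.2.symm, ?_⟩
      simpa using hp.1
    · intro q _
      simp
    · intro p _
      simp
  rw [hPhi]
  simp only [Set.coe_setOf, Nat.card_eq_fintype_card, Fintype.card_subtype]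
  rw [Finset.card_eq_sum_card_fiberwise
    (f := fun p : G × G => ((p.1 : G ⧸ N), (p.2 : G ⧸ N)))
    (t := Finset.univ.filter fun u : (G ⧸ N) × (G ⧸ N) => Subgroup.closure {u.1, u.2} = ⊤)]
  · rw [← smul_eq_mul, ← Finset.sum_const]
    refine Finset.sum_congr rfl fun w hw => ?_
    have e := genOver_card_eq N w ((g1 : G ⧸ N), (g2 : G ⧸ N)) (Finset.mem_filter.1 hw).2 hg ⊤
    rw [← e, Finset.filter_filter]
    rfl
  · intro p hp
    simp only [Finset.coe_filter, Finset.mem_univ, true_and, Set.mem_setOf_eq] at hp ⊢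
    rw [← map_closure_pair', hp, Subgroup.map_top_of_surjective _ (QuotientGroup.mk'_surjective N)]
end
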